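/- Let λ ∈ ℝ be exponentially transcendental, let n ∈ ℕ, and let x = (x₁,…,xₙ) ∈ ℝⁿ be such that the tuple (exp(x₁),…,exp(xₙ)) is multiplicatively independent. Then the transcendence degree of the field ℚ(λ, exp(x₁),…,exp(xₙ), exp(λx₁),…,exp(λxₙ)) over ℚ(λ) is at least n. -/

import Mathlib

/-- `x` is exponentially algebraic over `A ⊆ ℝ`: there are `n ≥ 1`, a tuple `xs` with
`xs 0 = x`, and `n` exponential polynomials (polynomials in variables `X₁,…,Xₙ,Y₁,…,Yₙ`,
with coefficients in the subring generated by `A ∪ ℤ`, where `Yⱼ` stands for `exp Xⱼ`)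
vanishing at `(xs, exp xs)` with nonvanishing Jacobian determinant there; the `(i,j)`
Jacobian entry is the total derivative `∂fᵢ/∂Xⱼ + exp(xⱼ)·∂fᵢ/∂Yⱼ` at `(xs, exp xs)`. -/
def IsExpAlgebraicOver (A : Set ℝ) (x : ℝ) : Prop :=
  ∃ (n : ℕ) (hn : 0 < n) (xs : Fin n → ℝ)
    (f : Fin n → MvPolynomial (Fin n ⊕ Fin n) ℝ),
    xs ⟨0, hn⟩ = x ∧
    (∀ i m, MvPolynomial.coeff m (f i) ∈ Subring.closure A) ∧
    (∀ i, MvPolynomial.eval (Sum.elim xs fun j => Real.exp (xs j)) (f i) = 0) ∧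
    (Matrix.of fun i j =>
        MvPolynomial.eval (Sum.elim xs fun j => Real.exp (xs j))
          (MvPolynomial.pderiv (Sum.inl j) (f i)) +
        Real.exp (xs j) *
          MvPolynomial.eval (Sum.elim xs fun j => Real.exp (xs j))
            (MvPolynomial.pderiv (Sum.inr j) (f i))).det ≠ 0

/-- `x` is exponentially algebraic (over `∅`, i.e. with integer coefficients). -/
def IsExpAlgebraic (x : ℝ) : Prop := IsExpAlgebraicOver ∅ x

/-- `td X Y` : the transcendence degree of the field `ℚ(X ∪ Y)` over `ℚ(Y)`,
realized as the supremum of the cardinalities of subsets of `ℚ(X ∪ Y)` that are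
algebraically independent over `ℚ(Y)`. -/
noncomputable def td {F : Type*} [Field F] (X Y : Set F) : Cardinal :=
  ⨆ s : {s : Set F // s ⊆ ↑(Subfield.closure (X ∪ Y)) ∧
      AlgebraicIndependent ↥(Subfield.closure Y) ((↑) : s → F)}, Cardinal.mk s.1

section DerivationExtension

/-- Every extension of fields of characteristic zero is formally smooth. -/
theorem formallySmooth_of_charZero (k F : Type*) [Field k] [Field F] [Algebra k F] [CharZero k] :
    Algebra.FormallySmooth k F := by
  obtain ⟨s, hs⟩ := exists_isTranscendenceBasis k F
  have := hs.isAlgebraic_field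
  exact .of_algebraicIndependent_of_isSeparable hs.1

/-- A ring homomorphism from a subring of a field of characteristic zero to a nilpotent thickening
of this field extends to the field. -/
theorem exists_ringHom_lift_of_injective {A F B : Type*} [CommRing A] [Field F] [CharZero F]
    [CommRing B] (j : A →+* F) (hj : Function.Injective j) (φ : A →+* B) (π : B →+* F)
    (hπ : Function.Surjective π) (hker : IsNilpotent (RingHom.ker π)) (h : π.comp φ = j) :
    ∃ ψ : F →+* B, ψ.comp j = φ ∧ π.comp ψ = RingHom.id F := by
  have hA : IsDomain A := hj.isDomain j
  let := j.toAlgebra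
  let := φ.toAlgebra
  have hinj : Function.Injective (algebraMap A F) := hj
  have : FaithfulSMul A F := (faithfulSMul_iff_algebraMap_injective A F).2 hinj
  have : CharZero A := ⟨fun a b hab => by simpa using congrArg j hab⟩
  let : Algebra (FractionRing A) F := FractionRing.liftAlgebra A F
  have : CharZero (FractionRing A) :=
    ⟨fun a b hab => by simpa using congrArg (algebraMap (FractionRing A) F) hab⟩
  have := formallySmooth_of_charZero (FractionRing A) F
  have : Algebra.FormallySmooth A (FractionRing A) := .of_isLocalization (nonZeroDivisors A)
  have : Algebra.FormallySmooth A F := .comp A (FractionRing A) F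
  let g : B →ₐ[A] F := { π with commutes' := fun a => congrArg (fun f => f a) h }
  let ψ := Algebra.FormallySmooth.liftOfSurjective (AlgHom.id A F) g hπ hker
  refine ⟨ψ, ?_, ?_⟩
  · ext a
    exact ψ.commutes a
  · ext x
    exact Algebra.FormallySmooth.liftOfSurjective_apply (AlgHom.id A F) g hπ hker x

theorem exists_derivation_extension {A F : Type*} [CommRing A] [Field F] [CharZero F]
    (j : A →+* F) (hj : Function.Injective j) (φ : A →+* DualNumber F)
    (h : ∀ a, (φ a).fst = j a) :
    ∃ D : Derivation ℤ F F, ∀ a, D (j a) = (φ a).snd := by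
  let π : DualNumber F →+* F := (TrivSqZeroExt.fstHom F F F).toRingHom
  obtain ⟨ψ, h1, h2⟩ := exists_ringHom_lift_of_injective j hj φ π
    (fun x => ⟨TrivSqZeroExt.inl x, by simp [π]⟩)
    ⟨2, by
      rw [pow_two, Ideal.zero_eq_bot, eq_bot_iff, Ideal.mul_le]
      intro r hr s hs
      have hr' : r.fst = 0 := hr
      have hs' : s.fst = 0 := hs
      rw [Ideal.mem_bot]
      ext <;> simp [hr', hs']⟩ (by ext a; exact h a)
  have h3 : ∀ x, (ψ x).fst = x := fun x => congrArg (fun f => f x) h2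
  refine ⟨Derivation.mk'
    { toFun := fun x => (ψ x).snd
      map_add' := by simp
      map_smul' := by simp } ?_, ?_⟩
  · intro a b
    simp [h3, mul_comm]
  · intro a
    have : ψ (j a) = φ a := congrArg (fun f => f a) h1
    simp [this]

/-- A map satisfying the rules of differentiation is a derivation. Stated for a generic ring, where
the `ℤ`-algebra structure is unambiguous. -/
theorem Derivation.exists_coe_eq {R : Type*} [CommRing R] (d : R → R)
    (hadd : ∀ a b, d (a + b) = d a + d b) (hmul : ∀ a b, d (a * b) = a * d b + b * d a) :
    ∃ D : Derivation ℤ R R, ∀ a, D a = d a :=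
  ⟨Derivation.mk' (AddMonoidHom.mk' d hadd).toIntLinearMap (by simpa using hmul), fun _ => rfl⟩

theorem leibniz_zpow_of_add_mul {R : Type*} [Field R] (d : R → R)
    (hadd : ∀ a b, d (a + b) = d a + d b) (hmul : ∀ a b, d (a * b) = a * d b + b * d a)
    (a : R) (n : ℤ) : d (a ^ n) = n * a ^ (n - 1) * d a := by
  obtain ⟨D, hD⟩ := Derivation.exists_coe_eq d hadd hmul
  rw [← hD, Derivation.leibniz_zpow, hD]
  simp [mul_assoc]

end DerivationExtension

section DerivationKernel

variable {F : Type*} [Field F]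

/-- The field of constants of a derivation on a field. -/
def Derivation.constants (D : Derivation ℤ F F) : Subfield F where
  carrier := {x | D x = 0}
  mul_mem' := by
    intro a b ha hb
    simp_all
  one_mem' := by simp
  add_mem' := by
    intro a b ha hb
    simp_all
  zero_mem' := by simp
  neg_mem' := by simp
  inv_mem' := by
    intro x hx
    simp_all [Derivation.leibniz_inv]

theorem Derivation.mem_constants {D : Derivation ℤ F F} {x : F} : x ∈ D.constants ↔ D x = 0 :=
  Iff.rfl

/-- A derivation with constants `k`, as a `k`-linear derivation. -/
def Derivation.linearOver (D : Derivation ℤ F F) (k : Subfield F) (hk : ∀ c ∈ k, D c = 0) :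
    Derivation k F F :=
  Derivation.mk'
    { toFun := D
      map_add' := by simp
      map_smul' := by
        intro c x
        simp [Subfield.smul_def, hk c c.2] }
    (by simp)

/-- A derivation vanishing on a subfield vanishes on everything algebraic over it. -/
theorem Derivation.eq_zero_of_isAlgebraic [CharZero F] (D : Derivation ℤ F F) (k : Subfield F)
    (hk : ∀ c ∈ k, D c = 0) {x : F} (hx : IsAlgebraic k x) : D x = 0 := by
  have h := (D.linearOver k hk).map_aeval (minpoly k x) x
  rw [minpoly.aeval, map_zero, smul_eq_mul, eq_comm, mul_eq_zero] at h
  refine h.resolve_left ?_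
  exact (minpoly.irreducible hx.isIntegral).separable.aeval_derivative_ne_zero (minpoly.aeval k x)

end DerivationKernel

section Residue

variable {k : Type*} [Field k]

open Polynomial

/-- The rational functions without pole at `0`. -/
def RatFunc.regularAtZero (k : Type*) [Field k] : Subring (RatFunc k) where
  carrier := {f | ∃ p q : k[X], q.eval 0 ≠ 0 ∧
    f * algebraMap k[X] (RatFunc k) q = algebraMap k[X] (RatFunc k) p}
  mul_mem' := by
    rintro a b ⟨p, q, hq, h⟩ ⟨p', q', hq', h'⟩
    refine ⟨p * p', q * q', by simp [hq, hq'], ?_⟩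
    rw [map_mul, map_mul, ← h, ← h']
    ring
  one_mem' := ⟨1, 1, by simp, by simp⟩
  add_mem' := by
    rintro a b ⟨p, q, hq, h⟩ ⟨p', q', hq', h'⟩
    refine ⟨p * q' + p' * q, q * q', by simp [hq, hq'], ?_⟩
    rw [map_mul, map_add, map_mul, map_mul, ← h, ← h']
    ring
  zero_mem' := ⟨0, 1, by simp, by simp⟩
  neg_mem' := by
    rintro a ⟨p, q, hq, h⟩
    exact ⟨-p, q, hq, by rw [map_neg, ← h]; ring⟩

theorem RatFunc.algebraMap_ne_zero_of_eval {q : k[X]} (hq : q.eval 0 ≠ 0) :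
    algebraMap k[X] (RatFunc k) q ≠ 0 := by
  intro h
  have : q = 0 := (map_eq_zero_iff _ (RatFunc.algebraMap_injective k)).1 h
  exact hq (by simp [this])

theorem RatFunc.algebraMap_mem_regularAtZero (p : k[X]) :
    algebraMap k[X] (RatFunc k) p ∈ RatFunc.regularAtZero k :=
  ⟨p, 1, by simp, by simp⟩

theorem RatFunc.C_mem_regularAtZero (a : k) : RatFunc.C a ∈ RatFunc.regularAtZero k := by
  simpa using RatFunc.algebraMap_mem_regularAtZero (Polynomial.C a)

theorem RatFunc.X_mem_regularAtZero : (RatFunc.X : RatFunc k) ∈ RatFunc.regularAtZero k := by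
  simpa using RatFunc.algebraMap_mem_regularAtZero (Polynomial.X : k[X])

theorem RatFunc.inv_mem_regularAtZero {q : k[X]} (hq : q.eval 0 ≠ 0) :
    (algebraMap k[X] (RatFunc k) q)⁻¹ ∈ RatFunc.regularAtZero k :=
  ⟨1, q, hq, by simp [inv_mul_cancel₀ (RatFunc.algebraMap_ne_zero_of_eval hq)]⟩

theorem RatFunc.eq_zero_of_C_eq_X_mul {a : k} {g : RatFunc k} (hg : g ∈ RatFunc.regularAtZero k)
    (h : RatFunc.C a = RatFunc.X * g) : a = 0 := by
  obtain ⟨p, q, hq, hpq⟩ := hg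
  have : algebraMap k[X] (RatFunc k) (Polynomial.C a * q) =
      algebraMap k[X] (RatFunc k) (Polynomial.X * p) := by
    rw [map_mul, map_mul, ← hpq, RatFunc.algebraMap_C, RatFunc.algebraMap_X, h]
    ring
  have := congrArg (Polynomial.eval 0) (RatFunc.algebraMap_injective k this)
  simpa [hq] using this

theorem RatFunc.exists_eq_X_zpow_mul {f : RatFunc k} (hf : f ≠ 0) :
    ∃ (m : ℤ) (h : RatFunc k), h ≠ 0 ∧ h ∈ RatFunc.regularAtZero k ∧
      h⁻¹ ∈ RatFunc.regularAtZero k ∧ f = RatFunc.X ^ m * h := by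
  have key : ∀ p : k[X], p ≠ 0 → ∃ (n : ℕ) (q : k[X]), q.eval 0 ≠ 0 ∧ p = Polynomial.X ^ n * q := by
    intro p hp
    obtain ⟨q, hq, hnd⟩ := Polynomial.exists_eq_pow_rootMultiplicity_mul_and_not_dvd p hp 0
    refine ⟨p.rootMultiplicity 0, q, ?_, by simpa using hq⟩
    rwa [Polynomial.dvd_iff_isRoot] at hnd
  obtain ⟨n, p, hp, hn⟩ := key f.num (RatFunc.num_ne_zero hf)
  obtain ⟨n', q, hq, hn'⟩ := key f.denom (RatFunc.denom_ne_zero f)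
  have hp0 := RatFunc.algebraMap_ne_zero_of_eval hp
  have hq0 := RatFunc.algebraMap_ne_zero_of_eval hq
  refine ⟨n - n', algebraMap k[X] (RatFunc k) p * (algebraMap k[X] (RatFunc k) q)⁻¹, ?_, ?_, ?_, ?_⟩
  · exact mul_ne_zero hp0 (inv_ne_zero hq0)
  · exact mul_mem (RatFunc.algebraMap_mem_regularAtZero p) (RatFunc.inv_mem_regularAtZero hq)
  · rw [mul_inv, inv_inv]
    exact mul_mem (RatFunc.inv_mem_regularAtZero hp) (RatFunc.algebraMap_mem_regularAtZero q)
  · rw [← RatFunc.num_div_denom f, hn, hn', map_mul, map_mul, map_pow, map_pow,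
      RatFunc.algebraMap_X, zpow_sub₀ RatFunc.X_ne_zero, zpow_natCast, zpow_natCast]
    field_simp

variable (D : RatFunc k → RatFunc k) (hadd : ∀ a b, D (a + b) = D a + D b)
  (hmul : ∀ a b, D (a * b) = a * D b + b * D a) (hX : D RatFunc.X = 1)
  (hC : ∀ a, D (RatFunc.C a) = 0)

include hadd hmul hX hC in
theorem RatFunc.derivation_algebraMap (p : k[X]) :
    D (algebraMap k[X] (RatFunc k) p) = algebraMap k[X] (RatFunc k) (derivative p) := by
  induction p using Polynomial.induction_on' with
  | add p q hp hq => simp [hp, hq, hadd]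
  | monomial n a =>
    rw [← Polynomial.C_mul_X_pow_eq_monomial]
    have := leibniz_zpow_of_add_mul D hadd hmul RatFunc.X n
    cases n with
    | zero => simp [hC]
    | succ n =>
      rw [zpow_natCast] at this
      simp [hX, hC, hmul, this]

include hadd hmul hX hC in
theorem RatFunc.derivation_mem_regularAtZero {f : RatFunc k} (hf : f ∈ RatFunc.regularAtZero k) :
    D f ∈ RatFunc.regularAtZero k := by
  obtain ⟨p, q, hq, h⟩ := hf
  have h1 := congrArg D h
  have hq0 := RatFunc.algebraMap_ne_zero_of_eval hq
  rw [hmul, RatFunc.derivation_algebraMap D hadd hmul hX hC,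
    RatFunc.derivation_algebraMap D hadd hmul hX hC] at h1
  refine ⟨derivative p * q - p * derivative q, q * q, by simp [hq], ?_⟩
  rw [map_sub, map_mul, map_mul, map_mul, ← h1, ← h]
  ring

include hadd hmul hX hC in
theorem RatFunc.exists_X_mul_logDeriv {h : RatFunc k} (m : ℤ) (h0 : h ≠ 0)
    (h1 : h ∈ RatFunc.regularAtZero k) (h2 : h⁻¹ ∈ RatFunc.regularAtZero k) :
    ∃ g ∈ RatFunc.regularAtZero k, RatFunc.X * (D (RatFunc.X ^ m * h) / (RatFunc.X ^ m * h)) =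
      RatFunc.C (m : k) + RatFunc.X * g := by
  have hX0 : (RatFunc.X : RatFunc k) ≠ 0 := RatFunc.X_ne_zero
  refine ⟨D h * h⁻¹, mul_mem (RatFunc.derivation_mem_regularAtZero D hadd hmul hX hC h1) h2, ?_⟩
  rw [hmul, leibniz_zpow_of_add_mul D hadd hmul, hX, zpow_sub_one₀ hX0]
  simp only [mul_one, map_intCast]
  field_simp
  ring

include hadd hmul hX hC in
/-- A nontrivial combination of logarithmic derivatives of rational functions, with coefficients
linearly independent over `ℤ`, can only be exact if no term has a residue. -/
theorem RatFunc.eq_zero_of_sum_logDeriv_eq [CharZero k] {ι : Type*} [Fintype ι] (b : ι → k)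
    (hb : ∀ m : ι → ℤ, ∑ i, (m i : k) * b i = 0 → ∀ i, m i = 0) (U : ι → RatFunc k)
    (hU : ∀ i, U i ≠ 0) (V : RatFunc k) (h : D V = ∑ i, RatFunc.C (b i) * (D (U i) / U i))
    (i₀ : ι) (d : ℤ) (hd : U i₀ = RatFunc.X ^ d) : d = 0 := by
  classical
  have hX0 : (RatFunc.X : RatFunc k) ≠ 0 := RatFunc.X_ne_zero
  have h1 : ∀ i, ∃ (m : ℤ) (g : RatFunc k), g ∈ RatFunc.regularAtZero k ∧
      RatFunc.X * (D (U i) / U i) = RatFunc.C (m : k) + RatFunc.X * g ∧ (i = i₀ → m = d) := by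
    intro i
    by_cases hi : i = i₀
    · subst hi
      obtain ⟨g, hg, hg'⟩ := RatFunc.exists_X_mul_logDeriv D hadd hmul hX hC d one_ne_zero
          (one_mem _)
        (by simp)
      exact ⟨d, g, hg, by simpa [hd] using hg', fun _ => rfl⟩
    · obtain ⟨m, f, hf0, hf, hf', hm⟩ := RatFunc.exists_eq_X_zpow_mul (hU i)
      obtain ⟨g, hg, hg'⟩ := RatFunc.exists_X_mul_logDeriv D hadd hmul hX hC m hf0 hf hf'
      exact ⟨m, g, hg, by rw [hm, hg'], fun h => absurd h hi⟩
  choose m g hg hm hmd using h1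
  set s : k := ∑ i, (m i : k) * b i with hs
  have h2 : ∃ G ∈ RatFunc.regularAtZero k, RatFunc.X * D V = RatFunc.C s + RatFunc.X * G := by
    refine ⟨∑ i, RatFunc.C (b i) * g i,
      sum_mem fun i _ => mul_mem (RatFunc.C_mem_regularAtZero _) (hg i), ?_⟩
    rw [h, hs, map_sum, Finset.mul_sum, Finset.mul_sum, ← Finset.sum_add_distrib]
    refine Finset.sum_congr rfl fun i _ => ?_
    rw [mul_left_comm, hm, map_mul]
    ring
  obtain ⟨G, hG, hGV⟩ := h2
  have hs0 : s = 0 := by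
    rcases eq_or_ne V 0 with rfl | hV
    · refine RatFunc.eq_zero_of_C_eq_X_mul (neg_mem hG) ?_
      have h0 := hC 0
      rw [map_zero] at h0
      rw [h0, mul_zero] at hGV
      linear_combination -hGV
    · obtain ⟨e, f, hf0, hf, hf', rfl⟩ := RatFunc.exists_eq_X_zpow_mul hV
      have hDf := RatFunc.derivation_mem_regularAtZero D hadd hmul hX hC hf
      have hfull : RatFunc.X * D (RatFunc.X ^ e * f) =
          RatFunc.X ^ e * ((e : RatFunc k) * f + RatFunc.X * D f) := by
        rw [hmul, leibniz_zpow_of_add_mul D hadd hmul, hX, zpow_sub_one₀ hX0]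
        simp only [mul_one]
        field_simp
        ring
      rw [hfull] at hGV
      rcases lt_trichotomy e 0 with he | rfl | he
      · exfalso
        obtain ⟨n, hn⟩ : ∃ n : ℕ, -e = n + 1 := ⟨(-e - 1).toNat, by omega⟩
        have hpow : (RatFunc.X : RatFunc k) ^ e * (RatFunc.X ^ n * RatFunc.X) = 1 := by
          rw [← pow_succ, ← zpow_natCast, ← zpow_add₀ hX0]
          have : e + ((n + 1 : ℕ) : ℤ) = 0 := by push_cast; omega
          rw [this, zpow_zero]
        have h3 : RatFunc.C (e : k) = RatFunc.X *
            ((RatFunc.X ^ n * (RatFunc.C s + RatFunc.X * G) - D f) * f⁻¹) := by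
          rw [map_intCast]
          field_simp
          linear_combination RatFunc.X ^ n * RatFunc.X * hGV -
            ((e : RatFunc k) * f + RatFunc.X * D f) * hpow
        have := RatFunc.eq_zero_of_C_eq_X_mul (mul_mem (sub_mem (mul_mem
          (pow_mem RatFunc.X_mem_regularAtZero n) (add_mem (RatFunc.C_mem_regularAtZero s)
          (mul_mem RatFunc.X_mem_regularAtZero hG))) hDf) hf') h3
        rw [Int.cast_eq_zero] at this
        omega
      · refine RatFunc.eq_zero_of_C_eq_X_mul (sub_mem hDf hG) ?_
        simp at hGV
        linear_combination -hGV
      · obtain ⟨n, hn⟩ : ∃ n : ℕ, e = n + 1 := ⟨(e - 1).toNat, by omega⟩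
        refine RatFunc.eq_zero_of_C_eq_X_mul (sub_mem (mul_mem
          (pow_mem RatFunc.X_mem_regularAtZero n) (add_mem (mul_mem (intCast_mem _ e) hf)
          (mul_mem RatFunc.X_mem_regularAtZero hDf))) hG) ?_
        rw [hn, zpow_add_one₀ hX0, zpow_natCast, ← hn] at hGV
        linear_combination -hGV
  rw [← hmd i₀ rfl]
  exact hb m hs0 i₀

end Residue

section TraceNorm

theorem Derivation.exists_extension_of_isField {L F : Type*} [Field L] [Field F] [CharZero F]
    [Algebra L F]
    (d : Derivation ℤ L L) :
    ∃ D : Derivation ℤ F F, ∀ a, D (algebraMap L F a) = algebraMap L F (d a) := by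
  let φ : L →+* DualNumber F :=
    { toFun := fun a => TrivSqZeroExt.inl (algebraMap L F a) +
        TrivSqZeroExt.inr (algebraMap L F (d a))
      map_one' := by ext <;> simp
      map_zero' := by ext <;> simp
      map_add' := by intro a b; ext <;> simp [-DualNumber.inr_eq_smul_eps]
      map_mul' := by intro a b; ext <;> simp [-DualNumber.inr_eq_smul_eps, mul_comm] }
  obtain ⟨D, hD⟩ := exists_derivation_extension (algebraMap L F) (algebraMap L F).injective φ
    (by simp [φ])
  exact ⟨D, fun a => by simp [hD, φ, -DualNumber.inr_eq_smul_eps]⟩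

open scoped Differential in
theorem Differential.deriv_trace_and_logDeriv_norm {L K : Type*} [Field L] [CharZero L] [Field K]
    [Algebra L K] [FiniteDimensional L K] [Differential L] [Differential K]
    [DifferentialAlgebra L K] :
    (∀ v : K, (Algebra.trace L K v)′ = Algebra.trace L K v′) ∧
    ∀ u : K, u ≠ 0 →
      logDeriv (Algebra.norm L u) = Algebra.trace L K (logDeriv u) := by
  let E := AlgebraicClosure L
  obtain ⟨D, hD⟩ := Derivation.exists_extension_of_isField (F := E) (Differential.deriv (R := L))
  let : Differential E := ⟨D⟩
  have : DifferentialAlgebra L E := ⟨hD⟩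
  have hσ : ∀ (σ : K →ₐ[L] E) x, σ (x′) = (σ x)′ := fun σ x => by
    rw [algHom_deriv' σ σ.toRingHom.injective]
  have hinj := (algebraMap L E).injective
  constructor
  · intro v
    apply hinj
    rw [← deriv_algebraMap, trace_eq_sum_embeddings E, trace_eq_sum_embeddings E, map_sum]
    simp [hσ]
  · intro u hu
    apply hinj
    rw [← logDeriv_algebraMap, Algebra.norm_eq_prod_embeddings L E, trace_eq_sum_embeddings E,
      logDeriv_prod _ _ _ (by intro σ _; simpa using hu)]
    simp [logDeriv, hσ]

/-- Logarithmic-exponential relations descend along algebraic extensions, by taking traces. -/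
theorem Derivation.exists_descent_of_isAlgebraic {L F : Type*} [Field L] [CharZero L] [Field F]
    [Algebra L F] [Algebra.IsAlgebraic L F] (d : Derivation ℤ L L) (D : Derivation ℤ F F)
    (hD : ∀ a, D (algebraMap L F a) = algebraMap L F (d a))
    {κ : Type*} [Fintype κ] (b : κ → L) (v : F) (u : κ → F) (hu : ∀ j, u j ≠ 0)
    (h : D v = ∑ j, algebraMap L F (b j) * (D (u j) / u j)) :
    ∃ (V : L) (U : κ → L) (N : ℕ), N ≠ 0 ∧ (∀ j, U j ≠ 0) ∧
      d V = ∑ j, b j * (d (U j) / U j) ∧ ∀ j x, u j = algebraMap L F x → U j = x ^ N := by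
  let K := IntermediateField.adjoin L (insert v (Set.range u))
  have : FiniteDimensional L K := by
    have := ((Set.finite_range u).insert v).to_subtype
    exact IntermediateField.finiteDimensional_adjoin fun x _ =>
      Algebra.IsIntegral.isIntegral x
  let : Differential L := ⟨d⟩
  let : Differential F := ⟨D⟩
  have : DifferentialAlgebra L F := ⟨hD⟩
  have hv : v ∈ K := IntermediateField.subset_adjoin _ _ (by simp)
  have hu' : ∀ j, u j ∈ K := fun j => IntermediateField.subset_adjoin _ _ (by simp)
  have hu0 : ∀ j, (⟨u j, hu' j⟩ : K) ≠ 0 := fun j h0 => hu j (congrArg Subtype.val h0)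
  have hK : ∀ x : K, ((Differential.deriv x : K) : F) = D x := fun x =>
    (DifferentialAlgebra.deriv_algebraMap (A := K) (B := F) x).symm
  obtain ⟨htr, hnorm⟩ := Differential.deriv_trace_and_logDeriv_norm (L := L) (K := K)
  have hrel : Differential.deriv (⟨v, hv⟩ : K) =
      ∑ j, b j • Differential.logDeriv (⟨u j, hu' j⟩ : K) := by
    apply Subtype.val_injective
    rw [hK]
    simp only [h, Differential.logDeriv]
    push_cast
    simp [hK, Algebra.smul_def]
  refine ⟨Algebra.trace L K ⟨v, hv⟩, fun j => Algebra.norm L (⟨u j, hu' j⟩ : K),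
    Module.finrank L K, Module.finrank_pos.ne', fun j => ?_, ?_, fun j x hx => ?_⟩
  · exact Algebra.norm_ne_zero_iff.2 (hu0 j)
  · refine (htr _).trans ?_
    rw [hrel, map_sum]
    refine Finset.sum_congr rfl fun j _ => ?_
    refine ((Algebra.trace L K).map_smul _ _).trans ?_
    rw [← hnorm _ (hu0 j), smul_eq_mul]
    rfl
  · have : (⟨u j, hu' j⟩ : K) = algebraMap L K x := Subtype.val_injective hx
    simp only [this]
    exact Algebra.norm_algebraMap x

end TraceNorm

section LogDerivRelation

open Polynomial

theorem IntermediateField.exists_transcendental_isAlgebraic_adjoin {C F : Type*} [Field C] [Field F]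
    [Algebra C F] {u : F} (hu : Transcendental C u) :
    ∃ k : IntermediateField C F, Transcendental k u ∧
      Algebra.IsAlgebraic (IntermediateField.adjoin C (insert u (k : Set F))) F := by
  have h1 : AlgebraicIndepOn C id ({u} : Set F) := by
    refine (algebraicIndependent_singleton_iff (⟨u, rfl⟩ : ({u} : Set F))).2 hu
  obtain ⟨s, hs, hb⟩ := exists_isTranscendenceBasis_superset h1
  refine ⟨IntermediateField.adjoin C (s \ {u}), ?_, ?_⟩
  · rw [IntermediateField.transcendental_adjoin_iff]
    have hus : u ∈ s := hs rfl
    have := hb.1.transcendental_adjoin (s := {x : s | (x : F) ≠ u}) (i := ⟨u, hus⟩) (by simp)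
    have himg : id ∘ Subtype.val '' {x : s | (x : F) ≠ u} = s \ {u} := by
      ext x
      simp [and_comm]
    rw [← himg]
    exact this
  · have := hb.isAlgebraic_field
    refine Algebra.IsAlgebraic.ringHom_of_comp_eq (R := IntermediateField.adjoin C
      (Set.range ((↑) : s → F))) (A := F) (IntermediateField.inclusion ?_) (RingHom.id F)
      (IntermediateField.inclusion_injective _) Function.surjective_id ?_
    · rw [IntermediateField.adjoin_le_iff, Subtype.range_coe]
      intro x hx
      by_cases hxu : x = u
      · exact IntermediateField.subset_adjoin _ _ (Or.inl hxu)
      · exact IntermediateField.subset_adjoin _ _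
          (Or.inr (IntermediateField.subset_adjoin _ _ ⟨hx, hxu⟩))
    · rfl

theorem exists_fun_extending {A F : Type*} [CommRing A] [Field F] [CharZero F]
    (j : A →+* F) (hj : Function.Injective j) (φ : A →+* DualNumber F)
    (h : ∀ a, (φ a).fst = j a) :
    ∃ d : F → F, (∀ a b, d (a + b) = d a + d b) ∧ (∀ a b, d (a * b) = a * d b + b * d a) ∧
      ∀ a, d (j a) = (φ a).snd := by
  obtain ⟨D, hD⟩ := exists_derivation_extension j hj φ h
  exact ⟨D, by simp, by simp, hD⟩

/-- The derivation `d/dX` of the field of rational functions, as a function. -/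
theorem RatFunc.exists_deriv (k : Type*) [Field k] [CharZero k] :
    ∃ d : RatFunc k → RatFunc k, (∀ a b, d (a + b) = d a + d b) ∧
      (∀ a b, d (a * b) = a * d b + b * d a) ∧ d RatFunc.X = 1 ∧ ∀ a, d (RatFunc.C a) = 0 := by
  have hinj := RatFunc.algebraMap_injective k
  let φ : k[X] →+* DualNumber (RatFunc k) :=
    eval₂RingHom ((TrivSqZeroExt.inlHom _ _).comp (RatFunc.C))
      (TrivSqZeroExt.inl RatFunc.X + TrivSqZeroExt.inr 1)
  have hφ : ∀ p, (φ p).fst = algebraMap k[X] (RatFunc k) p := by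
    intro p
    let ψ : k[X] →+* RatFunc k :=
      (TrivSqZeroExt.fstHom (RatFunc k) (RatFunc k) (RatFunc k)).toRingHom.comp φ
    have : ψ = algebraMap k[X] (RatFunc k) := by
      ext
      · simp [ψ, φ]
      · simp [ψ, φ]
    exact congrArg (fun f => f p) this
  obtain ⟨D, hadd, hmul, hD⟩ := exists_fun_extending (algebraMap k[X] (RatFunc k)) hinj φ hφ
  refine ⟨D, hadd, hmul, ?_, fun a => ?_⟩
  · rw [← RatFunc.algebraMap_X, hD]
    simp [φ]
  · rw [← RatFunc.algebraMap_C, hD]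
    simp [φ]

/-- If a logarithmic-exponential relation with coefficients that are linearly independent over `ℤ`
holds for all derivations over `C`, then its logarithmic arguments are algebraic over `C`. -/
theorem Subfield.isAlgebraic_of_forall_derivation_eq {F : Type*} [Field F] [CharZero F]
    (C : Subfield F) {κ : Type*} [Fintype κ] (b : κ → C)
    (hb : ∀ m : κ → ℤ, ∑ i, (m i : C) * b i = 0 → ∀ i, m i = 0) (v : F) (u : κ → F)
    (hu : ∀ j, u j ≠ 0)
    (h : ∀ δ : Derivation ℤ F F, (∀ c ∈ C, δ c = 0) → δ v = ∑ j, (b j : F) * (δ (u j) / u j))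
    (j₀ : κ) : IsAlgebraic C (u j₀) := by
  by_contra htr
  obtain ⟨k, hk, halg⟩ := IntermediateField.exists_transcendental_isAlgebraic_adjoin htr
  have hinj : Function.Injective (aeval (R := k) (u j₀)) := transcendental_iff_injective.1 hk
  let g : RatFunc k →ₐ[k] F := RatFunc.liftAlgHom (aeval (R := k) (u j₀))
    (nonZeroDivisors_le_comap_nonZeroDivisors_of_injective _ hinj)
  have hgX : g RatFunc.X = u j₀ := by
    rw [← RatFunc.algebraMap_X]
    have := RatFunc.liftAlgHom_apply_div (aeval (R := k) (u j₀))
      (nonZeroDivisors_le_comap_nonZeroDivisors_of_injective _ hinj) X 1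
    simpa using this
  have hgC : ∀ a : k, g (RatFunc.C a) = a := fun a => g.commutes a
  let : Algebra (RatFunc k) F := g.toRingHom.toAlgebra
  have hmap : ∀ x, algebraMap (RatFunc k) F x = g x := fun _ => rfl
  have : Algebra.IsAlgebraic (RatFunc k) F := by
    have hle : IntermediateField.adjoin C (insert (u j₀) (k : Set F)) ≤
        (g.restrictScalars C).fieldRange := by
      rw [IntermediateField.adjoin_le_iff]
      rintro x (rfl | hx)
      · exact ⟨_, hgX⟩
      · exact ⟨_, hgC ⟨x, hx⟩⟩
    let e := AlgEquiv.ofInjectiveField (g.restrictScalars C)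
    refine Algebra.IsAlgebraic.ringHom_of_comp_eq
      (R := IntermediateField.adjoin C (insert (u j₀) (k : Set F))) (A := F)
      (e.symm.toAlgHom.comp (IntermediateField.inclusion hle)) (RingHom.id F)
      (RingHom.injective _) Function.surjective_id ?_
    ext x
    exact congrArg Subtype.val (e.apply_symm_apply (IntermediateField.inclusion hle x))
  obtain ⟨d, hdadd, hdmul, hdX, hdC⟩ := RatFunc.exists_deriv k
  obtain ⟨d₂, hd₂⟩ := Derivation.exists_coe_eq d hdadd hdmul
  obtain ⟨D, hD⟩ := Derivation.exists_extension_of_isField (F := F) d₂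
  have hDC : ∀ c ∈ C, D c = 0 := by
    intro c hc
    have := hD (RatFunc.C (algebraMap C k ⟨c, hc⟩))
    rw [hmap, hgC] at this
    refine this.trans ?_
    refine (congrArg g ((hd₂ _).trans (hdC _))).trans (map_zero g)
  obtain ⟨V, U, N, hN, hU, hV, hN'⟩ := Derivation.exists_descent_of_isAlgebraic _ D hD
    (fun j => RatFunc.C (algebraMap C k (b j))) v u hu (by
      rw [h D hDC]
      refine Finset.sum_congr rfl fun j _ => ?_
      rw [hmap, hgC]
      rfl)
  have := RatFunc.eq_zero_of_sum_logDeriv_eq d hdadd hdmul hdX hdC (fun j => algebraMap C k (b j))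
    (fun m hm => hb m (by
      apply (algebraMap C k).injective
      simpa using hm)) U hU V (by simpa only [hd₂] using hV) j₀ N
      (by rw [hN' j₀ RatFunc.X (by rw [hmap, hgX]), zpow_natCast])
  exact hN (by exact_mod_cast this)

end LogDerivRelation

section ProdZpow

theorem Derivation.logDeriv_prod_zpow {F : Type*} [Field F] (δ : Derivation ℤ F F) {ι : Type*}
    [Fintype ι] (w : ι → F) (hw : ∀ i, w i ≠ 0) (m : ι → ℤ) :
    δ (∏ i, w i ^ m i) / ∏ i, w i ^ m i = ∑ i, m i * (δ (w i) / w i) := by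
  let : Differential F := ⟨δ⟩
  refine (Differential.logDeriv_prod ι Finset.univ (fun i => w i ^ m i)
    (fun i _ => zpow_ne_zero _ (hw i))).trans (Finset.sum_congr rfl fun i _ => ?_)
  have : δ (w i ^ m i) = m i * w i ^ (m i - 1) * δ (w i) := by
    simp [Derivation.leibniz_zpow, mul_assoc]
  refine (congrArg (· / w i ^ m i) this).trans ?_
  have := hw i
  have := zpow_ne_zero (m i) this
  rw [zpow_sub_one₀ (hw i)]
  field_simp

theorem Subfield.exists_prod_zpow_isAlgebraic {F : Type*} [Field F] [CharZero F]
    (C : Subfield F) {ι : Type*} [Fintype ι] (c : ι → C) (hc : c ≠ 0) (v : F) (w : ι → F)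
    (hw : ∀ i, w i ≠ 0)
    (h : ∀ δ : Derivation ℤ F F, (∀ x ∈ C, δ x = 0) → δ v = ∑ i, (c i : F) * (δ (w i) / w i)) :
    ∃ m : ι → ℤ, m ≠ 0 ∧ IsAlgebraic C (∏ i, w i ^ m i) := by
  classical
  let M : Submodule ℤ C := Submodule.span ℤ (Set.range c)
  have : Module.Finite ℤ M := Module.Finite.span_of_finite ℤ (Set.finite_range c)
  let b := Module.Free.chooseBasis ℤ M
  have hcM : ∀ i, c i ∈ M := fun i => Submodule.subset_span ⟨i, rfl⟩
  let m : ι → Module.Free.ChooseBasisIndex ℤ M → ℤ := fun i => b.repr ⟨c i, hcM i⟩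
  have hm : ∀ i, c i = ∑ j, (m i j : C) * (b j : C) := by
    intro i
    have := congrArg Subtype.val (b.sum_repr ⟨c i, hcM i⟩)
    refine this.symm.trans ?_
    simp [-Module.Basis.sum_repr, m]
  obtain ⟨i₀, hi₀⟩ : ∃ i, c i ≠ 0 := Function.ne_iff.1 hc
  obtain ⟨j₀, hj₀⟩ : ∃ j, m i₀ j ≠ 0 := by
    by_contra! h0
    exact hi₀ (by rw [hm]; simp [h0])
  refine ⟨fun i => m i j₀, fun h0 => hj₀ (congrFun h0 i₀), ?_⟩
  refine C.isAlgebraic_of_forall_derivation_eq (fun j => (b j : C)) ?_ v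
    (fun j => ∏ i, w i ^ m i j)
    (fun j => Finset.prod_ne_zero_iff.2 fun i _ => zpow_ne_zero _ (hw i)) (fun δ hδ => ?_) j₀
  · intro p hp
    refine Fintype.linearIndependent_iff.1 b.linearIndependent p ?_
    apply Subtype.val_injective
    simpa using hp
  · rw [h δ hδ]
    simp only [Derivation.logDeriv_prod_zpow δ w hw, Finset.mul_sum]
    rw [Finset.sum_comm]
    refine Finset.sum_congr rfl fun i _ => ?_
    rw [hm i]
    push_cast
    rw [Finset.sum_mul]
    exact Finset.sum_congr rfl fun j _ => by ring

end ProdZpow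

section Ax

theorem LinearMap.exists_ne_zero_dotProduct_eq_zero {F V : Type*} [Field F] [AddCommGroup V]
    [Module F V] {ι τ : Type*} [Fintype ι] [Fintype τ] (f : V →ₗ[F] (ι → F)) (g : V →ₗ[F] (τ → F))
    (hker : ∀ x, g x = 0 → f x = 0) {x₀ : V} (hf : f x₀ = 0) (hg : g x₀ ≠ 0)
    (hcard : Fintype.card τ ≤ Fintype.card ι) :
    ∃ c : ι → F, c ≠ 0 ∧ ∀ x, ∑ i, c i * f x i = 0 := by
  classical
  obtain ⟨σ, hσ⟩ := g.rangeRestrict.exists_rightInverse_of_surjective g.range_rangeRestrict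
  have hfac : ∀ x, f x = f (σ (g.rangeRestrict x)) := by
    intro x
    rw [← sub_eq_zero, ← map_sub]
    apply hker
    have := congrArg Subtype.val (LinearMap.congr_fun hσ (g.rangeRestrict x))
    rw [map_sub, sub_eq_zero]
    exact this.symm
  have hlt : Module.finrank F (LinearMap.range (f ∘ₗ σ)) <
      Module.finrank F (LinearMap.range g) := by
    have h1 := (f ∘ₗ σ).finrank_range_add_finrank_ker
    have h2 : 0 < Module.finrank F (LinearMap.ker (f ∘ₗ σ)) := by
      refine (Module.finrank_pos_iff_exists_ne_zero (R := F)
        (M := LinearMap.ker (f ∘ₗ σ))).2 ⟨⟨g.rangeRestrict x₀, ?_⟩, fun h0 => hg ?_⟩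
      · rw [LinearMap.mem_ker, LinearMap.comp_apply, ← hfac, hf]
      · exact congrArg Subtype.val (congrArg Subtype.val h0)
    omega
  have hlt' : Module.finrank F (LinearMap.range (f ∘ₗ σ)) < Module.finrank F (ι → F) := by
    refine hlt.trans_le ((Submodule.finrank_le _).trans ?_)
    simpa using hcard
  obtain ⟨φ, hφ, hle⟩ := (LinearMap.range (f ∘ₗ σ)).exists_le_ker_of_lt_top
    (lt_top_iff_ne_top.2 fun h => by
    rw [h, finrank_top] at hlt'
    exact lt_irrefl _ hlt')
  have hφ' : ∀ y, φ y = ∑ i, φ (Pi.single i 1) * y i := by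
    intro y
    conv_lhs => rw [pi_eq_sum_univ' y, map_sum]
    simp [mul_comm]
  refine ⟨fun i => φ (Pi.single i 1), fun h0 => hφ ?_, fun x => ?_⟩
  · ext i
    simpa using congrFun h0 i
  · rw [← hφ', hfac]
    exact hle ⟨_, rfl⟩

theorem Derivation.card_lt_card_of_exponential_relations {F : Type*} [Field F] [CharZero F]
    (D : Derivation ℤ F F) (l : F) (hl : D l ≠ 0) {ι τ : Type*} [Fintype ι] [Fintype τ]
    (v w : ι → F) (t : τ → F) (hw : ∀ i, w i ≠ 0) (hexp : ∀ i, D (w i) = w i * D (v i))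
    (hgen : ∀ δ : Derivation ℤ F F, (∀ c, D c = 0 → δ c = 0) → (∀ j, δ (t j) = 0) →
      δ l = 0 ∧ ∀ i, δ (v i) = 0 ∧ δ (w i) = 0)
    (hind : ∀ m : ι → ℤ, D (∑ i, m i * v i) = 0 → m = 0) :
    Fintype.card ι < Fintype.card τ := by
  classical
  by_contra! hcard
  let C := D.constants
  let D' : Derivation C F F := D.linearOver C fun _ h => h
  have hD' : ∀ x, D' x = D x := fun _ => rfl
  have hC : ∀ δ : Derivation C F F, ∀ c ∈ C, δ c = 0 := fun δ c hc => δ.map_algebraMap ⟨c, hc⟩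
  let f : Derivation C F F →ₗ[F] (ι → F) :=
    { toFun := fun δ i => δ (v i) - δ (w i) / w i
      map_add' := fun a b => by ext i; simp; ring
      map_smul' := fun a b => by ext i; simp; ring }
  let g : Derivation C F F →ₗ[F] (τ → F) :=
    { toFun := fun δ j => δ (t j)
      map_add' := fun a b => by ext i; simp
      map_smul' := fun a b => by ext i; simp }
  have hgen' : ∀ δ : Derivation C F F, g δ = 0 → δ l = 0 ∧ ∀ i, δ (v i) = 0 ∧ δ (w i) = 0 := by
    intro δ hδ
    obtain ⟨δ', hδ'⟩ := Derivation.exists_coe_eq δ (by simp) (by simp)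
    have := hgen δ' (fun c hc => by rw [hδ']; exact hC δ c hc)
      (fun j => by rw [hδ']; exact congrFun hδ j)
    simpa only [hδ'] using this
  obtain ⟨c, hc0, hc⟩ := f.exists_ne_zero_dotProduct_eq_zero g (x₀ := D')
    (fun δ hδ => by
      ext i
      simp [f, (hgen' δ hδ).2 i])
    (by ext i; simp [f, hD', hexp, hw])
    (fun h0 => hl (hgen' D' h0).1) hcard
  have hbr : ∀ δ i, D (f δ i) = f ⁅D', δ⁆ i := by
    intro δ i
    have h1 : D (δ (w i) / w i) = (D (δ (w i)) * w i - δ (w i) * D (w i)) / w i ^ 2 := by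
      rw [Derivation.leibniz_div]
      simp only [smul_eq_mul]
      have := hw i
      field_simp
    simp only [f, LinearMap.coe_mk, AddHom.coe_mk, map_sub, Derivation.commutator_apply, hD', h1,
      hexp, Derivation.leibniz, smul_eq_mul]
    have := hw i
    field_simp
    ring
  -- a nonzero vector of minimal support
  let S : Set (ι → F) := {c | c ≠ 0 ∧ ∀ δ, ∑ i, c i * f δ i = 0}
  let supp : (ι → F) → ℕ := fun c => (Finset.univ.filter fun i => c i ≠ 0).card
  obtain ⟨c₁, ⟨hc₁0, hc₁⟩, hmin⟩ := WellFounded.has_min (measure supp).wf S ⟨c, hc0, hc⟩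
  obtain ⟨i₀, hi₀⟩ : ∃ i, c₁ i ≠ 0 := Function.ne_iff.1 hc₁0
  let e : ι → F := fun i => (c₁ i₀)⁻¹ * c₁ i
  have he : ∀ δ, ∑ i, e i * f δ i = 0 := fun δ => by
    simp only [e, mul_assoc, ← Finset.mul_sum, hc₁ δ, mul_zero]
  have he₀ : e i₀ = 1 := inv_mul_cancel₀ hi₀
  have hDe : ∀ i, D (e i) = 0 := by
    by_contra! hne
    refine hmin (fun i => D (e i)) ⟨fun h0 => ?_, fun δ => ?_⟩ ?_
    · obtain ⟨i, hi⟩ := hne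
      exact hi (congrFun h0 i)
    · have h1 : D (∑ i, e i * f δ i) = 0 := by rw [he, map_zero]
      rw [map_sum] at h1
      simp only [Derivation.leibniz, smul_eq_mul, hbr,
        Finset.sum_add_distrib, he, zero_add] at h1
      simpa only [mul_comm] using h1
    · refine Finset.card_lt_card ⟨fun i hi => ?_, fun hsub => ?_⟩
      · simp only [Finset.mem_filter, Finset.mem_univ, true_and] at hi ⊢
        intro h0
        exact hi (by simp [e, h0])
      · have := hsub (by simpa using hi₀ : i₀ ∈ _)
        simp [he₀] at this
  obtain ⟨m, hm, halg⟩ := C.exists_prod_zpow_isAlgebraic (fun i => (⟨e i, hDe i⟩ : C))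
    (fun h0 => one_ne_zero (α := F) (he₀.symm.trans (congrArg Subtype.val (congrFun h0 i₀))))
    (∑ i, e i * v i) w hw (fun δ hδ => by
      have h1 := he (δ.linearOver C hδ)
      have h2 : ∀ i, f (δ.linearOver C hδ) i = δ (v i) - δ (w i) / w i := fun _ => rfl
      simp only [h2, mul_sub, Finset.sum_sub_distrib, sub_eq_zero] at h1
      simpa [hδ _ (hDe _)] using h1)
  refine hm (hind m ?_)
  have h1 := D.eq_zero_of_isAlgebraic C (fun _ h => h) halg
  have h2 := D.logDeriv_prod_zpow w hw m
  rw [h1, zero_div] at h2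
  simp only [hexp, mul_div_cancel_left₀ _ (hw _)] at h2
  simpa [Derivation.leibniz] using h2.symm

end Ax

section ExpPolynomial

open MvPolynomial

/-- Evaluation of an exponential polynomial with integer coefficients. -/
noncomputable def expEval {ι : Type*} (p : ι → ℝ) : MvPolynomial (ι ⊕ ι) ℤ →ₐ[ℤ] ℝ :=
  aeval (Sum.elim p fun i => Real.exp (p i))

/-- The total derivative of an exponential polynomial with respect to the `j`-th variable. -/
noncomputable def expDeriv {ι : Type*} (j : ι) :
    Derivation ℤ (MvPolynomial (ι ⊕ ι) ℤ) (MvPolynomial (ι ⊕ ι) ℤ) :=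
  pderiv (Sum.inl j) + (X (Sum.inr j) : MvPolynomial (ι ⊕ ι) ℤ) • pderiv (Sum.inr j)

variable {ι : Type*}

@[simp]
theorem expEval_X_inl (p : ι → ℝ) (i : ι) : expEval p (X (Sum.inl i)) = p i := by
  simp [expEval]

@[simp]
theorem expEval_X_inr (p : ι → ℝ) (i : ι) : expEval p (X (Sum.inr i)) = Real.exp (p i) := by
  simp [expEval]

theorem expDeriv_apply (j : ι) (f : MvPolynomial (ι ⊕ ι) ℤ) :
    expDeriv j f = pderiv (Sum.inl j) f + X (Sum.inr j) * pderiv (Sum.inr j) f := rfl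

theorem expDeriv_X_inl [DecidableEq ι] (i j : ι) :
    expDeriv j (X (Sum.inl i)) = if i = j then 1 else 0 := by
  simp [expDeriv_apply, pderiv_X, Pi.single_apply]

theorem expDeriv_X_inr [DecidableEq ι] (i j : ι) :
    expDeriv j (X (Sum.inr i)) = if i = j then X (Sum.inr j) else 0 := by
  simp [expDeriv_apply, pderiv_X, Pi.single_apply, eq_comm]

theorem expEval_intCast (p : ι → ℝ) (n : ℤ) : expEval p (C n) = n := by
  simp [expEval]

/-- The gradient of an exponential polynomial. -/
noncomputable def expGrad (p : ι → ℝ) (f : MvPolynomial (ι ⊕ ι) ℤ) : ι → ℝ :=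
  fun j => expEval p (expDeriv j f)

theorem expGrad_add (p : ι → ℝ) (f g : MvPolynomial (ι ⊕ ι) ℤ) :
    expGrad p (f + g) = expGrad p f + expGrad p g := by
  ext j
  simp [expGrad]

theorem expGrad_mul (p : ι → ℝ) (f g : MvPolynomial (ι ⊕ ι) ℤ) :
    expGrad p (f * g) = expEval p f • expGrad p g + expEval p g • expGrad p f := by
  ext j
  simp [expGrad]

theorem expGrad_C (p : ι → ℝ) (n : ℤ) : expGrad p (C n) = 0 := by
  ext j
  simp [expGrad]

theorem expGrad_X_inl [DecidableEq ι] (p : ι → ℝ) (i : ι) :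
    expGrad p (X (Sum.inl i)) = Pi.single i 1 := by
  ext j
  simp [expGrad, expDeriv_X_inl, Pi.single_apply, apply_ite, eq_comm]

theorem expGrad_X_inr [DecidableEq ι] (p : ι → ℝ) (i : ι) :
    expGrad p (X (Sum.inr i)) = Pi.single i (Real.exp (p i)) := by
  ext j
  rcases eq_or_ne i j with rfl | h
  · simp [expGrad, expDeriv_X_inr]
  · simp [expGrad, expDeriv_X_inr, h]

theorem hasStrictFDerivAt_expEval [Fintype ι] (f : MvPolynomial (ι ⊕ ι) ℤ) (p : ι → ℝ) :
    HasStrictFDerivAt (fun p => expEval p f)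
      (∑ j, expGrad p f j • ContinuousLinearMap.proj (R := ℝ) (φ := fun _ : ι => ℝ) j) p := by
  classical
  induction f using MvPolynomial.induction_on with
  | C n =>
    simp only [expEval_intCast, expGrad_C]
    simpa using hasStrictFDerivAt_const (n : ℝ) p
  | add f g hf hg =>
    simp only [map_add]
    convert! hf.add hg using 1
    simp [expGrad_add, add_smul, Finset.sum_add_distrib]
  | mul_X f n hf =>
    have hX : HasStrictFDerivAt (fun p => expEval p (X n))
        (∑ j, expGrad p (X n) j • ContinuousLinearMap.proj (R := ℝ) (φ := fun _ : ι => ℝ) j)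
        p := by
      rcases n with i | i
      · simp only [expEval_X_inl, expGrad_X_inl]
        convert! (ContinuousLinearMap.proj (R := ℝ) (φ := fun _ : ι => ℝ) i).hasStrictFDerivAt
          using 1
        simp [Pi.single_apply]
      · simp only [expEval_X_inr, expGrad_X_inr]
        convert! ((ContinuousLinearMap.proj (R := ℝ) (φ := fun _ : ι => ℝ) i).hasStrictFDerivAt
          (x := p)).exp using 1
        simp [Pi.single_apply]
    simp only [map_mul]
    convert! hf.mul hX using 1
    simp [expGrad_mul, add_smul, Finset.sum_add_distrib, Finset.smul_sum, mul_smul]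

theorem contDiff_expEval [Fintype ι] (f : MvPolynomial (ι ⊕ ι) ℤ) {n : WithTop ℕ∞} :
    ContDiff ℝ n (fun p : ι → ℝ => expEval p f) := by
  induction f using MvPolynomial.induction_on with
  | C m => simpa only [expEval_intCast] using contDiff_const
  | add f g hf hg => simpa only [map_add] using hf.add hg
  | mul_X f i hf =>
    simp only [map_mul]
    refine hf.mul ?_
    rcases i with i | i
    · simpa using contDiff_apply ℝ ℝ i
    · simpa using (contDiff_apply ℝ ℝ i).exp

theorem exists_exponential_derivation [Fintype ι] (a u : ι → ℝ)
    (h : ∀ f, expEval a f = 0 → ∑ j, u j * expGrad a f j = 0) :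
    ∃ D : Derivation ℤ ℝ ℝ, ∀ j, D (a j) = u j ∧ D (Real.exp (a j)) = Real.exp (a j) * u j := by
  classical
  let φ : MvPolynomial (ι ⊕ ι) ℤ →ₐ[ℤ] DualNumber ℝ :=
    aeval (Sum.elim (fun j => (TrivSqZeroExt.inl (a j) + TrivSqZeroExt.inr (u j) : DualNumber ℝ))
      fun j => TrivSqZeroExt.inl (Real.exp (a j)) + TrivSqZeroExt.inr (Real.exp (a j) * u j))
  have hφ : ∀ f, (φ f).fst = expEval a f ∧ (φ f).snd = ∑ j, u j * expGrad a f j := by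
    intro f
    induction f using MvPolynomial.induction_on with
    | C n =>
      rw [expEval_intCast, expGrad_C]
      simp [φ]
    | add f g hf hg =>
      simp [map_add, hf, hg, expGrad_add, mul_add, Finset.sum_add_distrib]
    | mul_X f i hf =>
      have hX : (φ (X i)).fst = expEval a (X i) ∧
          (φ (X i)).snd = ∑ j, u j * expGrad a (X i) j := by
        rcases i with i | i
        · simp [φ, expGrad_X_inl, Pi.single_apply, -DualNumber.inr_eq_smul_eps]
        · simp [φ, expGrad_X_inr, Pi.single_apply, mul_comm, -DualNumber.inr_eq_smul_eps]
      refine ⟨by simp [hf, hX], ?_⟩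
      simp only [map_mul, TrivSqZeroExt.snd_mul, hf, hX, expGrad_mul, Pi.add_apply, Pi.smul_apply,
        smul_eq_mul, mul_add, Finset.sum_add_distrib, Finset.mul_sum, MulOpposite.smul_eq_mul_unop,
        MulOpposite.unop_op, Finset.sum_mul]
      congr 1 <;> exact Finset.sum_congr rfl fun j _ => by ring
  let 𝔭 := RingHom.ker (expEval a)
  let φ' : (MvPolynomial (ι ⊕ ι) ℤ ⧸ 𝔭) →+* DualNumber ℝ :=
    Ideal.Quotient.lift 𝔭 φ.toRingHom fun f hf => by
      have hf' : expEval a f = 0 := hf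
      ext
      · exact (hφ f).1.trans hf'
      · exact (hφ f).2.trans (h f hf')
  obtain ⟨D, hD⟩ := exists_derivation_extension (RingHom.kerLift (expEval a).toRingHom)
    (RingHom.kerLift_injective _) φ' (fun x => by
      obtain ⟨f, rfl⟩ := Ideal.Quotient.mk_surjective x
      exact (hφ f).1)
  have hD' : ∀ f, D (expEval a f) = ∑ j, u j * expGrad a f j := fun f =>
    (hD (Ideal.Quotient.mk _ f)).trans (hφ f).2
  refine ⟨D, fun j => ⟨?_, ?_⟩⟩
  · simpa [expGrad_X_inl, Pi.single_apply] using hD' (X (Sum.inl j))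
  · simpa [expGrad_X_inr, Pi.single_apply, mul_comm] using hD' (X (Sum.inr j))

end ExpPolynomial

section Khovanskii

open MvPolynomial

variable {ι : Type*}

theorem eq_zero_of_hasDerivAt_mulVec {κ : Type*} [Fintype κ] (Z : ℝ → κ → ℝ)
    (A : ℝ → κ → κ → ℝ) (hA : ContinuousOn A (Set.Icc 0 1))
    (hZ : ∀ t ∈ Set.Icc (0 : ℝ) 1, HasDerivAt Z (fun r => ∑ r', A t r r' * Z t r') t)
    (h0 : Z 0 = 0) {t : ℝ} (ht : t ∈ Set.Icc (0 : ℝ) 1) : Z t = 0 := by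
  obtain ⟨B, hB⟩ := isCompact_Icc.exists_bound_of_continuousOn hA
  have hbound : ∀ t ∈ Set.Ico (0 : ℝ) 1,
      ‖fun r => ∑ r', A t r r' * Z t r'‖ ≤ (Fintype.card κ * B) * ‖Z t‖ + 0 := by
    intro t ht
    have hAt := hB t (Set.Ico_subset_Icc_self ht)
    have hB0 : 0 ≤ B := (norm_nonneg _).trans hAt
    rw [add_zero]
    refine (pi_norm_le_iff_of_nonneg (by positivity)).2 fun r => ?_
    calc ‖∑ r', A t r r' * Z t r'‖ ≤ ∑ r' : κ, B * ‖Z t‖ := by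
          refine norm_sum_le_of_le _ fun r' _ => ?_
          rw [norm_mul]
          gcongr
          · exact ((norm_le_pi_norm (A t r) r').trans (norm_le_pi_norm (A t) r)).trans hAt
          · exact norm_le_pi_norm (Z t) r'
      _ = _ := by simp [mul_assoc]
  have := norm_le_gronwallBound_of_norm_deriv_right_le (f := Z) (δ := 0)
    (fun t ht => (hZ t ht).continuousAt.continuousWithinAt)
    (fun t ht => (hZ t (Set.Ico_subset_Icc_self ht)).hasDerivWithinAt) (by simp [h0]) hbound t ht
  simpa [gronwallBound_ε0] using this

theorem exists_linearIndependent_expGrad [Fintype ι] (a : ι → ℝ) :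
    ∃ h : ι → MvPolynomial (ι ⊕ ι) ℤ, LinearIndependent ℝ (fun i => expGrad a (h i)) ∧
      ∀ v ∈ Submodule.span ℝ (expGrad a '' {f | expEval a f = 0}),
        v ∈ Submodule.span ℝ ((fun i => expGrad a (h i)) '' {i | expEval a (h i) = 0}) := by
  classical
  obtain ⟨b₀, hb₀, hspan₀, hli₀⟩ :=
    exists_linearIndependent ℝ (expGrad a '' {f | expEval a f = 0})
  obtain ⟨b, hb, hb₀b, hspan, hli⟩ := exists_linearIndepOn_id_extension
    (K := ℝ) (s := b₀) (t := Set.range (expGrad a)) hli₀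
    (hb₀.trans (Set.image_subset_range _ _))
  have htop : Submodule.span ℝ b = ⊤ := by
    rw [eq_top_iff, ← (Pi.basisFun ℝ ι).span_eq, Submodule.span_le]
    rintro _ ⟨i, rfl⟩
    refine hspan ⟨X (Sum.inl i), ?_⟩
    simp [expGrad_X_inl]
  let B : Module.Basis b ℝ (ι → ℝ) := Module.Basis.mk (v := ((↑) : b → ι → ℝ)) hli (by simp [htop])
  let e : ι ≃ b := (Pi.basisFun ℝ ι).indexEquiv B
  have hex : ∀ v : b, ∃ f, expGrad a f = v ∧ ((v : ι → ℝ) ∈ b₀ → expEval a f = 0) := by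
    intro v
    by_cases hv : (v : ι → ℝ) ∈ b₀
    · obtain ⟨f, hf, hfv⟩ := hb₀ hv
      exact ⟨f, hfv, fun _ => hf⟩
    · obtain ⟨f, hf⟩ := hb v.2
      exact ⟨f, hf, fun h => absurd h hv⟩
  choose f hf hf0 using hex
  refine ⟨fun i => f (e i), ?_, fun v hv => ?_⟩
  · simp only [hf]
    exact LinearIndependent.comp hli e e.injective
  · rw [← hspan₀] at hv
    refine Submodule.span_mono ?_ hv
    intro w hw
    refine ⟨e.symm ⟨w, hb₀b hw⟩, ?_, ?_⟩
    · simpa using hf0 ⟨w, hb₀b hw⟩ hw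
    · simp [hf]

/-- The Jacobian matrix of a family of exponential polynomials. -/
noncomputable def expJacobian (h : ι → MvPolynomial (ι ⊕ ι) ℤ) :
    Matrix ι ι (MvPolynomial (ι ⊕ ι) ℤ) :=
  Matrix.of fun i k => expDeriv k (h i)

variable [Fintype ι] [DecidableEq ι]

theorem expEval_expJacobian (h : ι → MvPolynomial (ι ⊕ ι) ℤ) (p : ι → ℝ) :
    (expEval p).toRingHom.mapMatrix (expJacobian h) = Matrix.of fun i => expGrad p (h i) := rfl

/-- The `i`-th partial derivative with respect to the coordinates `h`, multiplied by the
determinant of the Jacobian of `h`. -/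
noncomputable def adjugateDeriv (h : ι → MvPolynomial (ι ⊕ ι) ℤ) (i : ι)
    (g : MvPolynomial (ι ⊕ ι) ℤ) : MvPolynomial (ι ⊕ ι) ℤ :=
  ∑ k, (expJacobian h).adjugate k i * expDeriv k g

theorem expEval_adjugateDeriv (h : ι → MvPolynomial (ι ⊕ ι) ℤ) (i : ι)
    (g : MvPolynomial (ι ⊕ ι) ℤ) (p : ι → ℝ) :
    expEval p (adjugateDeriv h i g) =
      ∑ k, (Matrix.of fun i => expGrad p (h i)).adjugate k i * expGrad p g k := by
  rw [← expEval_expJacobian, ← RingHom.map_adjugate]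
  simp [adjugateDeriv, expGrad]

theorem expEval_det_expJacobian (h : ι → MvPolynomial (ι ⊕ ι) ℤ) (p : ι → ℝ) :
    expEval p (expJacobian h).det = (Matrix.of fun i => expGrad p (h i)).det := by
  rw [← expEval_expJacobian, ← RingHom.map_det]
  rfl

theorem expEval_adjugateDeriv_eq_zero (h : ι → MvPolynomial (ι ⊕ ι) ℤ) (a : ι → ℝ) {s : Set ι}
    {i : ι} (hi : i ∉ s) {g : MvPolynomial (ι ⊕ ι) ℤ}
    (hg : expGrad a g ∈ Submodule.span ℝ ((fun i => expGrad a (h i)) '' s)) :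
    expEval a (adjugateDeriv h i g) = 0 := by
  rw [expEval_adjugateDeriv]
  generalize expGrad a g = v at hg
  induction hg using Submodule.span_induction with
  | mem v hv =>
    obtain ⟨l, hl, rfl⟩ := hv
    have := congrFun (congrFun (Matrix.mul_adjugate (Matrix.of fun i => expGrad a (h i))) l) i
    rw [Matrix.mul_apply, Matrix.smul_apply, Matrix.one_apply_ne (by rintro rfl; exact hi hl),
      smul_zero] at this
    simpa [mul_comm] using this
  | zero => simp
  | add v w _ _ hv hw => simp [mul_add, Finset.sum_add_distrib, hv, hw]
  | smul c v _ hv => simp [mul_left_comm, ← Finset.mul_sum, hv]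

theorem hasStrictFDerivAt_expEval_pi (h : ι → MvPolynomial (ι ⊕ ι) ℤ) (p : ι → ℝ) :
    HasStrictFDerivAt (fun p i => expEval p (h i))
      (LinearMap.toContinuousLinearMap (Matrix.toLin' (Matrix.of fun i => expGrad p (h i)))) p := by
  rw [hasStrictFDerivAt_pi']
  intro i
  convert! hasStrictFDerivAt_expEval (h i) p using 1
  ext v
  simp [Matrix.mulVec, dotProduct]

omit [DecidableEq ι] in
theorem HasDerivAt.expEval {γ : ℝ → ι → ℝ} {γ' : ι → ℝ} {t : ℝ} (hγ : HasDerivAt γ γ' t)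
    (f : MvPolynomial (ι ⊕ ι) ℤ) :
    HasDerivAt (fun t => expEval (γ t) f) (∑ j, expGrad (γ t) f j * γ' j) t := by
  have := (hasStrictFDerivAt_expEval f (γ t)).hasFDerivAt.comp_hasDerivAt t hγ
  simpa [Function.comp_def] using this

/-- Near a point where the coordinates `h` have nonzero Jacobian, segments in the `h`-coordinates
lift to differentiable paths. -/
theorem exists_path_of_det_ne_zero (h : ι → MvPolynomial (ι ⊕ ι) ℤ) (a : ι → ℝ)
    (ha : (Matrix.of fun i => expGrad a (h i)).det ≠ 0) :
    ∃ ε > 0, ∀ s : ι → ℝ, ‖s‖ < ε → ∃ γ γ' : ℝ → ι → ℝ, γ 0 = a ∧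
      ∀ t ∈ Set.Icc (0 : ℝ) 1, HasDerivAt γ (γ' t) t ∧
        (∀ i, expEval (γ t) (h i) = expEval a (h i) + t * s i) ∧
        (Matrix.of fun i => expGrad (γ t) (h i)).det ≠ 0 ∧
        (Matrix.of fun i => expGrad (γ t) (h i)).mulVec (γ' t) = s := by
  let M := fun p : ι → ℝ => Matrix.of fun i => expGrad p (h i)
  have hM : ∀ p, (M p).det ≠ 0 → ∃ f' : (ι → ℝ) ≃L[ℝ] (ι → ℝ),
      (f' : (ι → ℝ) →L[ℝ] (ι → ℝ)) = LinearMap.toContinuousLinearMap (Matrix.toLin' (M p)) := by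
    intro p hp
    have : Invertible (M p) := Matrix.invertibleOfIsUnitDet _ (isUnit_iff_ne_zero.2 hp)
    exact ⟨(Matrix.toLinearEquiv' (M p) inferInstance).toContinuousLinearEquiv, by ext; rfl⟩
  obtain ⟨f', hf'⟩ := hM a ha
  have hstrict : HasStrictFDerivAt (fun p i => expEval p (h i))
      (f' : (ι → ℝ) →L[ℝ] (ι → ℝ)) a := hf' ▸ hasStrictFDerivAt_expEval_pi h a
  let φ := hstrict.toOpenPartialHomeomorph
  have hφ : ∀ p, φ p = fun i => expEval p (h i) := fun p => rfl
  have has : a ∈ φ.source := hstrict.mem_toOpenPartialHomeomorph_source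
  have hopen : IsOpen {p : ι → ℝ | (M p).det ≠ 0} := by
    have : Continuous fun p : ι → ℝ => expEval p (expJacobian h).det :=
      (contDiff_expEval (n := 0) _).continuous
    simp only [expEval_det_expJacobian] at this
    exact isOpen_ne_fun this continuous_const
  have hnhds := φ.symm.isOpen_inter_preimage hopen
  obtain ⟨ε, hε, hball⟩ := Metric.isOpen_iff.1 hnhds (φ a)
    ⟨φ.map_source has, by
      change (M (φ.symm (φ a))).det ≠ 0
      rwa [φ.left_inv has]⟩
  refine ⟨ε, hε, fun s hs => ?_⟩
  have hmem : ∀ t ∈ Set.Icc (0 : ℝ) 1, φ a + t • s ∈ φ.target ∧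
      (M (φ.symm (φ a + t • s))).det ≠ 0 := by
    intro t ht
    refine hball ?_
    rw [Metric.mem_ball, dist_eq_norm, add_sub_cancel_left, norm_smul, Real.norm_of_nonneg ht.1]
    exact (mul_le_of_le_one_left (norm_nonneg _) ht.2).trans_lt hs
  have key : ∀ t ∈ Set.Icc (0 : ℝ) 1, ∃ v, HasDerivAt (fun t : ℝ => φ.symm (φ a + t • s)) v t ∧
      (M (φ.symm (φ a + t • s))).mulVec v = s := by
    intro t ht
    obtain ⟨htgt, hdet⟩ := hmem t ht
    obtain ⟨g', hg'⟩ := hM _ hdet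
    have hd : HasFDerivAt φ (g' : (ι → ℝ) →L[ℝ] (ι → ℝ)) (φ.symm (φ a + t • s)) :=
      hg' ▸ (hasStrictFDerivAt_expEval_pi h _).hasFDerivAt
    have hlin : HasDerivAt (fun t : ℝ => φ a + t • s) s t := by
      simpa using ((hasDerivAt_id t).smul_const s).const_add (φ a)
    have hcomp := (φ.hasFDerivAt_symm htgt hd).comp_hasDerivAt t hlin
    refine ⟨g'.symm s, hcomp, ?_⟩
    have := congrArg (fun L => L (g'.symm s)) hg'
    simpa using this.symm
  choose! γ' hγ' using key
  refine ⟨fun t => φ.symm (φ a + t • s), γ', by simp [φ.left_inv has], fun t ht =>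
    ⟨(hγ' t ht).1, fun i => ?_, (hmem t ht).2, (hγ' t ht).2⟩⟩
  have := congrFun (φ.right_inv (hmem t ht).1) i
  simpa [hφ] using this

theorem det_mul_sum_expGrad_mul (h : ι → MvPolynomial (ι ⊕ ι) ℤ) (p v s : ι → ℝ)
    (hv : (Matrix.of fun i => expGrad p (h i)).mulVec v = s) (g : MvPolynomial (ι ⊕ ι) ℤ) :
    (Matrix.of fun i => expGrad p (h i)).det * ∑ j, expGrad p g j * v j =
      ∑ i, s i * expEval p (adjugateDeriv h i g) := by
  set M := Matrix.of fun i => expGrad p (h i) with hM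
  have hv' : M.det • v = M.adjugate.mulVec s := by
    rw [← hv, Matrix.mulVec_mulVec, Matrix.adjugate_mul, Matrix.smul_mulVec, Matrix.one_mulVec]
  have hv'' : ∀ j, M.det * v j = ∑ i, M.adjugate j i * s i := fun j => congrFun hv' j
  simp_rw [expEval_adjugateDeriv, ← hM, Finset.mul_sum]
  rw [Finset.sum_comm]
  refine Finset.sum_congr rfl fun j _ => ?_
  rw [mul_left_comm, hv'', Finset.mul_sum]
  exact Finset.sum_congr rfl fun i _ => by ring

theorem exists_regular_rational_system (a : ι → ℝ) (i₀ : ι)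
    (hi₀ : Pi.single i₀ 1 ∈ Submodule.span ℝ (expGrad a '' {f | expEval a f = 0})) :
    ∃ (h : ι → MvPolynomial (ι ⊕ ι) ℤ) (p : ι → ℝ), p i₀ = a i₀ ∧
      (∀ i, ∃ q : ℚ, expEval p (h i) = q) ∧ (Matrix.of fun i => expGrad p (h i)).det ≠ 0 := by
  obtain ⟨h, hli, hspan⟩ := exists_linearIndependent_expGrad a
  have hdet : (Matrix.of fun i => expGrad a (h i)).det ≠ 0 := by
    have := Matrix.linearIndependent_rows_iff_isUnit.1
      (show LinearIndependent ℝ (Matrix.of fun i => expGrad a (h i)).row from hli)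
    exact ((Matrix.isUnit_iff_isUnit_det _).1 this).ne_zero
  obtain ⟨ε, hε, hpath⟩ := exists_path_of_det_ne_zero h a hdet
  have hq : ∀ i, ∃ q : ℚ, |(q : ℝ) - expEval a (h i)| < ε / 2 ∧ (expEval a (h i) = 0 → q = 0) := by
    intro i
    by_cases hi : expEval a (h i) = 0
    · exact ⟨0, by simpa [hi] using hε, fun _ => rfl⟩
    · obtain ⟨q, hq⟩ := exists_rat_near (expEval a (h i)) (half_pos hε)
      exact ⟨q, by rwa [abs_sub_comm], fun h => absurd h hi⟩
  choose q hqε hq0 using hq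
  let s : ι → ℝ := fun i => q i - expEval a (h i)
  have hs : ‖s‖ < ε :=
    ((pi_norm_le_iff_of_nonneg (half_pos hε).le).2 fun i => (hqε i).le).trans_lt (half_lt_self hε)
  have hs0 : ∀ i, expEval a (h i) = 0 → s i = 0 := fun i hi => by simp [s, hi, hq0 i hi]
  obtain ⟨γ, γ', hγ0, hγ⟩ := hpath s hs
  have hγc : ContinuousOn γ (Set.Icc 0 1) := fun t ht => (hγ t ht).1.continuousAt.continuousWithinAt
  let 𝔭 : Ideal (MvPolynomial (ι ⊕ ι) ℤ) := RingHom.ker (expEval a)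
  have h𝔭 : ∀ g, expGrad a g ∈ Submodule.span ℝ (expGrad a '' {f | expEval a f = 0}) →
      ∀ i, expEval a (h i) ≠ 0 → adjugateDeriv h i g ∈ 𝔭 := fun g hg i hi =>
    expEval_adjugateDeriv_eq_zero h a (s := {i | expEval a (h i) = 0}) hi (hspan _ hg)
  have hderiv : ∀ g, ∀ t ∈ Set.Icc (0 : ℝ) 1, HasDerivAt (fun t => expEval (γ t) g)
      ((Matrix.of fun i => expGrad (γ t) (h i)).det⁻¹ *
        ∑ i, s i * expEval (γ t) (adjugateDeriv h i g)) t := by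
    intro g t ht
    obtain ⟨hd, -, hne, hv⟩ := hγ t ht
    rw [← det_mul_sum_expGrad_mul h _ _ _ hv, inv_mul_cancel_left₀ hne]
    exact hd.expEval g
  obtain ⟨G, hG⟩ := (isNoetherianRing_iff_ideal_fg _).1 inferInstance 𝔭
  have hmem : ∀ f ∈ 𝔭, ∃ c : G → MvPolynomial (ι ⊕ ι) ℤ, f = ∑ r, c r * (r : MvPolynomial _ ℤ) := by
    intro f hf
    rw [← hG, Submodule.mem_span_finset'] at hf
    obtain ⟨c, hc⟩ := hf
    exact ⟨c, hc.symm⟩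
  have hG𝔭 : ∀ r : G, (r : MvPolynomial (ι ⊕ ι) ℤ) ∈ 𝔭 := fun r =>
    hG ▸ Ideal.subset_span r.2
  have hcoef : ∀ (i : ι) (r : G), ∃ c : G → MvPolynomial (ι ⊕ ι) ℤ, expEval a (h i) ≠ 0 →
      adjugateDeriv h i r = ∑ r', c r' * (r' : MvPolynomial _ ℤ) := by
    intro i r
    by_cases hi : expEval a (h i) = 0
    · exact ⟨0, fun h => absurd hi h⟩
    · obtain ⟨c, hc⟩ := hmem _ (h𝔭 r (Submodule.subset_span ⟨r, hG𝔭 r, rfl⟩) i hi)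
      exact ⟨c, fun _ => hc⟩
  choose c hc using hcoef
  have hcont : ∀ f, ContinuousOn (fun t => expEval (γ t) f) (Set.Icc 0 1) := fun f =>
    (contDiff_expEval (n := 0) f).continuous.comp_continuousOn hγc
  have hGzero : ∀ t ∈ Set.Icc (0 : ℝ) 1, (fun r : G => expEval (γ t) r) = 0 := by
    intro t ht
    refine eq_zero_of_hasDerivAt_mulVec (fun t (r : G) => expEval (γ t) r)
      (fun t r r' => (Matrix.of fun i => expGrad (γ t) (h i)).det⁻¹ *
        ∑ i, s i * expEval (γ t) (c i r r')) ?_ ?_ ?_ ht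
    · refine continuousOn_pi.2 fun r => continuousOn_pi.2 fun r' => ContinuousOn.mul ?_ ?_
      · refine ContinuousOn.inv₀ ?_ fun t ht => (hγ t ht).2.2.1
        simpa only [expEval_det_expJacobian] using hcont (expJacobian h).det
      · exact continuousOn_finsetSum _ fun i _ => continuousOn_const.mul (hcont _)
    · intro t ht
      refine hasDerivAt_pi.2 fun r => ?_
      convert! hderiv r t ht using 1
      simp_rw [mul_assoc, ← Finset.mul_sum, Finset.sum_mul]
      rw [Finset.sum_comm]
      congr 1
      refine Finset.sum_congr rfl fun i _ => ?_
      by_cases hi : expEval a (h i) = 0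
      · simp [hs0 i hi]
      · rw [hc i r hi]
        simp [Finset.mul_sum, mul_assoc]
    · ext r
      simpa [hγ0, 𝔭] using hG𝔭 r
  have h𝔭zero : ∀ f ∈ 𝔭, ∀ t ∈ Set.Icc (0 : ℝ) 1, expEval (γ t) f = 0 := by
    intro f hf t ht
    obtain ⟨c, rfl⟩ := hmem f hf
    rw [map_sum]
    refine Finset.sum_eq_zero fun r _ => ?_
    rw [map_mul, show expEval (γ t) (r : MvPolynomial (ι ⊕ ι) ℤ) = 0 from congrFun (hGzero t ht) r,
      mul_zero]
  have hconst : ∀ t ∈ Set.Icc (0 : ℝ) 1, expEval (γ t) (X (Sum.inl i₀)) =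
      expEval (γ 0) (X (Sum.inl i₀)) := by
    refine constant_of_has_deriv_right_zero (hcont _) fun t ht => ?_
    have ht' := Set.Ico_subset_Icc_self ht
    convert! (hderiv (X (Sum.inl i₀)) t ht').hasDerivWithinAt using 1
    rw [Finset.sum_eq_zero, mul_zero]
    intro i _
    by_cases hi : expEval a (h i) = 0
    · rw [hs0 i hi, zero_mul]
    · rw [h𝔭zero _ (h𝔭 _ (by rwa [expGrad_X_inl]) i hi) t ht', mul_zero]
  have h1 : (1 : ℝ) ∈ Set.Icc (0 : ℝ) 1 := ⟨zero_le_one, le_rfl⟩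
  refine ⟨h, γ 1, ?_, fun i => ⟨q i, ?_⟩, (hγ 1 h1).2.2.1⟩
  · simpa [hγ0] using hconst 1 h1
  · rw [(hγ 1 h1).2.1 i]
    simp [s]

end Khovanskii

section

open MvPolynomial

theorem eval_map_castRingHom {ι : Type*} (p : ι → ℝ) (f : MvPolynomial (ι ⊕ ι) ℤ) :
    eval (Sum.elim p fun i => Real.exp (p i)) (map (Int.castRingHom ℝ) f) = expEval p f := by
  rw [eval_map, expEval, aeval_def]
  rfl

theorem isExpAlgebraic_of_regular_rational_system {n : ℕ} (hn : 0 < n)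
    (h : Fin n → MvPolynomial (Fin n ⊕ Fin n) ℤ) (p : Fin n → ℝ)
    (hq : ∀ i, ∃ q : ℚ, expEval p (h i) = q)
    (hdet : (Matrix.of fun i => expGrad p (h i)).det ≠ 0) : IsExpAlgebraic (p ⟨0, hn⟩) := by
  choose q hq using hq
  let f : Fin n → MvPolynomial (Fin n ⊕ Fin n) ℤ := fun i => C ((q i).den : ℤ) * h i - C (q i).num
  have hgrad : ∀ i, expGrad p (f i) = ((q i).den : ℝ) • expGrad p (h i) := by
    intro i
    ext j
    simp [f, expGrad]
  refine ⟨n, hn, p, fun i => map (Int.castRingHom ℝ) (f i), rfl, fun i m => ?_, fun i => ?_, ?_⟩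
  · rw [coeff_map]
    exact intCast_mem _ _
  · rw [eval_map_castRingHom]
    simp only [f, map_sub, map_mul, expEval_intCast, hq]
    rw [Int.cast_natCast, sub_eq_zero]
    exact_mod_cast Rat.den_mul_eq_num (q i)
  · have hrow : (Matrix.of fun i => expGrad p (f i)).det ≠ 0 := by
      have : (Matrix.of fun i => expGrad p (f i)) =
          Matrix.of fun i j => ((q i).den : ℝ) * (Matrix.of fun i => expGrad p (h i)) i j := by
        ext i j
        simp [hgrad]
      rw [this, Matrix.det_mul_column]
      refine mul_ne_zero (Finset.prod_ne_zero_iff.2 fun i _ => ?_) hdet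
      exact_mod_cast (q i).den_nz
    convert! hrow using 3
    ext i j
    simp only [pderiv_map, eval_map_castRingHom]
    simp [expGrad, expDeriv_apply]

/-- If `l` is exponentially transcendental, then any finite tuple containing `l` supports a
derivation respecting the exponentials of its entries and not killing `l`. -/
theorem exists_exponential_derivation_ne_zero {n : ℕ} (hn : 0 < n) (a : Fin n → ℝ)
    (ha : ¬ IsExpAlgebraic (a ⟨0, hn⟩)) :
    ∃ D : Derivation ℤ ℝ ℝ, D (a ⟨0, hn⟩) ≠ 0 ∧
      ∀ j, D (Real.exp (a j)) = Real.exp (a j) * D (a j) := by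
  have hnot : (Pi.single ⟨0, hn⟩ 1 : Fin n → ℝ) ∉
      Submodule.span ℝ (expGrad a '' {f | expEval a f = 0}) := by
    intro hmem
    obtain ⟨h, p, hp, hq, hdet⟩ := exists_regular_rational_system a _ hmem
    exact ha (hp ▸ isExpAlgebraic_of_regular_rational_system hn h p hq hdet)
  obtain ⟨φ, hφ, hle⟩ := Submodule.exists_le_ker_of_notMem hnot
  obtain ⟨D, hD⟩ := exists_exponential_derivation a (fun j => φ (Pi.single j 1)) (fun f hf => by
    have h0 : φ (expGrad a f) = 0 := hle (Submodule.subset_span ⟨f, hf, rfl⟩)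
    rw [← Finset.univ_sum_single (expGrad a f), map_sum] at h0
    rw [← h0]
    refine Finset.sum_congr rfl fun j _ => ?_
    rw [mul_comm, ← smul_eq_mul, ← map_smul]
    congr 1
    ext k
    simp [Pi.single_apply])
  exact ⟨D, by rwa [(hD _).1], fun j => by rw [(hD j).1, (hD j).2]⟩

end

section Kronecker

open Module

variable {F : Type*} [Field F] [CharZero F]

theorem Transcendental.linearIndependent_pow {K A : Type*} [Field K] [Ring A] [Algebra K A]
    {x : A} (hx : Transcendental K x) : LinearIndependent K fun i : ℕ => x ^ i := by
  have := (Polynomial.basisMonomials K).linearIndependent.map' (Polynomial.aeval x).toLinearMap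
    (LinearMap.ker_eq_bot.2 (transcendental_iff_injective.1 hx))
  simpa [Function.comp_def] using this

/-- The sum `V + lV + ⋯ + lᵐV`. -/
def iteratedSup (l : F) (V : Submodule ℚ F) : ℕ → Submodule ℚ F
  | 0 => V
  | m + 1 => iteratedSup l V m ⊔ (iteratedSup l V m).map (LinearMap.mulLeft ℚ l)

theorem pow_mul_mem_iteratedSup (l : F) (V : Submodule ℚ F) {v : F} (hv : v ∈ V) {i m : ℕ}
    (him : i ≤ m) : l ^ i * v ∈ iteratedSup l V m := by
  induction m generalizing i with
  | zero => simpa [Nat.le_zero.1 him, iteratedSup] using hv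
  | succ m ih =>
    rcases i with _ | i
    · exact Submodule.mem_sup_left (ih (Nat.zero_le _))
    · exact Submodule.mem_sup_right ⟨l ^ i * v, ih (Nat.le_of_succ_le_succ him), by
        simp [pow_succ', mul_assoc]⟩

instance finiteDimensional_iteratedSup (l : F) (V : Submodule ℚ F) [FiniteDimensional ℚ V]
    (m : ℕ) : FiniteDimensional ℚ (iteratedSup l V m) := by
  induction m with
  | zero => assumption
  | succ m ih =>
    rw [iteratedSup]
    infer_instance

theorem Nat.le_add_mul_of_concave {f : ℕ → ℕ} {q : ℕ} (h1 : f 1 ≤ f 0 + q)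
    (h : ∀ m, f (m + 2) + f m ≤ f (m + 1) + f (m + 1)) (m : ℕ) : f m ≤ f 0 + m * q := by
  have hstep : ∀ m, f (m + 1) ≤ f m + q := by
    intro m
    induction m with
    | zero => exact h1
    | succ m ih =>
      have : f (m + 1 + 1) + f m ≤ f (m + 1) + f (m + 1) := h m
      omega
  induction m with
  | zero => simp
  | succ m ih =>
    have := hstep m
    rw [Nat.add_mul, one_mul]
    omega

theorem finrank_iteratedSup_le {l : F} (hl : l ≠ 0) (V : Submodule ℚ F)
    [FiniteDimensional ℚ V] {q : ℕ} (hq : finrank ℚ (iteratedSup l V 1) ≤ finrank ℚ V + q) (m : ℕ) :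
    finrank ℚ (iteratedSup l V m) ≤ finrank ℚ V + m * q := by
  have hinj : Function.Injective (LinearMap.mulLeft ℚ l) := fun a b h => mul_left_cancel₀ hl h
  have hmap : ∀ W : Submodule ℚ F, finrank ℚ (W.map (LinearMap.mulLeft ℚ l)) = finrank ℚ W :=
    fun W => (Submodule.equivMapOfInjective _ hinj W).finrank_eq.symm
  refine Nat.le_add_mul_of_concave (f := fun m => finrank ℚ (iteratedSup l V m)) hq (fun m => ?_) m
  set W := iteratedSup l V (m + 1) with hW
  have hadd := Submodule.finrank_sup_add_finrank_inf_eq W (W.map (LinearMap.mulLeft ℚ l))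
  have hinf : (iteratedSup l V m).map (LinearMap.mulLeft ℚ l) ≤
      W ⊓ W.map (LinearMap.mulLeft ℚ l) :=
    le_inf le_sup_right (Submodule.map_mono le_sup_left)
  have hle := Submodule.finrank_mono hinf
  rw [hmap] at hle hadd
  change finrank ℚ ↥(W ⊔ W.map (LinearMap.mulLeft ℚ l)) + _ ≤ _
  omega

/-- A finite-dimensional rational space `V` and its multiple `lV` by a transcendental element `l`
of a field `K` together span a space of dimension at least `dim V + dim_K (KV)`. -/
theorem finrank_add_finrank_span_le {l : F} (hl : Transcendental ℚ l) (K : IntermediateField ℚ F)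
    (hlK : l ∈ K) (V : Submodule ℚ F) [FiniteDimensional ℚ V] :
    finrank ℚ V + finrank K (Submodule.span K (V : Set F)) ≤
      finrank ℚ ↥(V ⊔ V.map (LinearMap.mulLeft ℚ l)) := by
  have hl0 : l ≠ 0 := by
    rintro rfl
    exact hl isAlgebraic_zero
  obtain ⟨b, hbV, hspan, hb⟩ := exists_linearIndependent K (V : Set F)
  have hbQ : LinearIndependent ℚ ((↑) : b → F) := hb.restrict_scalars' ℚ
  have hbV' : LinearIndependent ℚ (fun x : b => (⟨x, hbV x.2⟩ : V)) :=
    LinearIndependent.of_comp V.subtype hbQ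
  have : Finite b := hbV'.finite
  let := Fintype.ofFinite b
  have hk : finrank K (Submodule.span K (V : Set F)) = Fintype.card b := by
    rw [← hspan]
    rw [← finrank_span_eq_card hb, Subtype.range_coe]
  have hV : finrank ℚ V ≤ finrank ℚ (iteratedSup l V 1) := Submodule.finrank_mono le_sup_left
  obtain ⟨q, hq⟩ := Nat.exists_eq_add_of_le hV
  have hlow : ∀ m, (m + 1) * Fintype.card b ≤ finrank ℚ (iteratedSup l V m) := by
    intro m
    have hpow : LinearIndependent ℚ (fun i : Fin (m + 1) => (⟨l, hlK⟩ : K) ^ (i : ℕ)) := by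
      refine LinearIndependent.of_comp K.val.toLinearMap ?_
      exact hl.linearIndependent_pow.comp _ Fin.val_injective
    have hprod := linearIndependent_smul hpow hb
    have hmem : LinearIndependent ℚ (fun p : Fin (m + 1) × b =>
        (⟨l ^ (p.1 : ℕ) * p.2, pow_mul_mem_iteratedSup l V (hbV p.2.2)
          (Nat.le_of_lt_succ p.1.2)⟩ : iteratedSup l V m)) :=
      LinearIndependent.of_comp (iteratedSup l V m).subtype hprod
    simpa using hmem.fintype_card_le_finrank
  rw [hk]
  change _ ≤ finrank ℚ (iteratedSup l V 1)
  rw [hq]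
  by_contra! hlt
  have h1 := (hlow (finrank ℚ V)).trans (finrank_iteratedSup_le hl0 V hq.le (finrank ℚ V))
  have h2 : q + 1 ≤ Fintype.card b := by omega
  nlinarith [Nat.mul_le_mul_left (finrank ℚ V + 1) h2]

/-- Rationally independent constants of a derivation remain independent over `ℚ(l)` if `l` is not
a constant. -/
theorem Derivation.linearIndependent_adjoin (D : Derivation ℤ F F) {l : F} (hl : D l ≠ 0)
    {κ : Type*} {c : κ → F} (hc : ∀ i, D (c i) = 0) (hli : LinearIndependent ℚ c) :
    LinearIndependent (IntermediateField.adjoin ℚ {l}) c := by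
  open scoped IntermediateField.algebraAdjoinAdjoin in
  refine (LinearIndependent.iff_fractionRing (Algebra.adjoin ℚ {l})
    (IntermediateField.adjoin ℚ {l})).1 ?_
  rw [linearIndependent_iff']
  intro s g hg i hi
  have hex : ∀ i, ∃ p : Polynomial ℚ, Polynomial.aeval l p = (g i : F) := fun i => by
    simpa [Algebra.adjoin_singleton_eq_range_aeval] using (g i).2
  choose p hp using hex
  let c' : κ → D.constants := fun i => ⟨c i, Derivation.mem_constants.2 (hc i)⟩
  let P : Polynomial D.constants :=
    ∑ i ∈ s, Polynomial.C (c' i) * (p i).map (algebraMap ℚ D.constants)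
  have hP : Polynomial.aeval l P = 0 := by
    rw [← hg, map_sum]
    refine Finset.sum_congr rfl fun i _ => ?_
    rw [map_mul, Polynomial.aeval_C, Polynomial.aeval_map_algebraMap, hp, mul_comm]
    rfl
  have hP0 : P = 0 := by
    by_contra hne
    exact hl (D.eq_zero_of_isAlgebraic D.constants (fun _ => Derivation.mem_constants.1)
      ⟨P, hne, hP⟩)
  have hcoeff : ∀ j, (p i).coeff j = 0 := by
    intro j
    have hj : ∑ i ∈ s, (p i).coeff j • c i = 0 := by
      have := congrArg (fun Q => ((Polynomial.coeff Q j : D.constants) : F)) hP0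
      simpa [P, Polynomial.finsetSum_coeff, c', Algebra.smul_def, mul_comm] using this
    exact linearIndependent_iff'.1 hli s _ hj i hi
  have hpi : p i = 0 := Polynomial.ext fun j => by simpa using hcoeff j
  exact Subtype.ext (by rw [← hp, hpi]; simp)

end Kronecker

section Counting

open Module

variable {F : Type*} [Field F] [CharZero F]

theorem Derivation.eq_zero_of_mem_adjoin (D : Derivation ℤ F F) {l : F} (hl : D l = 0) {x : F}
    (hx : x ∈ IntermediateField.adjoin ℚ {l}) : D x = 0 := by
  rw [← Derivation.mem_constants]
  induction hx using IntermediateField.adjoin_induction with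
  | mem x hx => exact Derivation.mem_constants.2 (by rwa [Set.mem_singleton_iff.1 hx])
  | algebraMap q => exact SubfieldClass.ratCast_mem _ q
  | add x y _ _ hx hy => exact add_mem hx hy
  | inv x _ hx => exact inv_mem hx
  | mul x y _ _ hx hy => exact mul_mem hx hy

/-- A derivation of a field of characteristic zero, as a rational linear map. -/
def Derivation.toRatLinearMap (D : Derivation ℤ F F) : F →ₗ[ℚ] F :=
  (D : F →+ F).toRatLinearMap

@[simp]
theorem Derivation.toRatLinearMap_apply (D : Derivation ℤ F F) (x : F) :
    D.toRatLinearMap x = D x := rfl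

/-- The constants of a derivation in a rational space `V'` and finitely many further elements,
whose number is controlled, span `V'` over `ℚ(l)`. -/
theorem Derivation.exists_finset_span (D : Derivation ℤ F F) {l : F} (hl : D l ≠ 0)
    (V : Submodule ℚ F) [FiniteDimensional ℚ V] :
    ∃ b : Finset F,
      (V : Set F) ⊆ Submodule.span (IntermediateField.adjoin ℚ {l}) ({c | D c = 0} ∪ (b : Set F)) ∧
      b.card + finrank ℚ ↥(V ⊓ LinearMap.ker D.toRatLinearMap) ≤
        finrank (IntermediateField.adjoin ℚ {l})
          (Submodule.span (IntermediateField.adjoin ℚ {l}) (V : Set F)) := by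
  classical
  set K := IntermediateField.adjoin ℚ {l}
  set E := V ⊓ LinearMap.ker D.toRatLinearMap
  have : FiniteDimensional ℚ E := Submodule.finiteDimensional_of_le (inf_le_left (a := V))
  let c : Fin (finrank ℚ E) → F := fun i => (finBasis ℚ E i : F)
  have hcQ : LinearIndependent ℚ c :=
    (finBasis ℚ E).linearIndependent.map' E.subtype (Submodule.ker_subtype _)
  have hc0 : ∀ i, D (c i) = 0 := fun i => (finBasis ℚ E i).2.2
  have hcK : LinearIndependent K c := D.linearIndependent_adjoin hl hc0 hcQ
  obtain ⟨B, hBV, hcB, hVB, hB⟩ := exists_linearIndepOn_id_extension (K := K)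
    hcK.linearIndepOn_id (Set.range_subset_iff.2 fun i => (finBasis ℚ E i).2.1)
  have hBQ : LinearIndependent ℚ (fun x : B => (⟨x, hBV x.2⟩ : V)) :=
    LinearIndependent.of_comp V.subtype (LinearIndependent.restrict_scalars' ℚ hB)
  have : Finite B := hBQ.finite
  let := Fintype.ofFinite B
  have hcard : finrank K (Submodule.span K (V : Set F)) = B.toFinset.card := by
    have hspan : Submodule.span K (V : Set F) = Submodule.span K B :=
      le_antisymm (Submodule.span_le.2 hVB) (Submodule.span_mono hBV)
    rw [hspan, Set.toFinset_card, ← finrank_span_eq_card hB]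
    change _ = finrank K (Submodule.span K (Set.range ((↑) : B → F)))
    rw [Subtype.range_coe]
  refine ⟨B.toFinset \ Finset.univ.image c, ?_, ?_⟩
  · refine hVB.trans (Submodule.span_mono fun x hx => ?_)
    by_cases hxc : x ∈ Set.range c
    · obtain ⟨i, rfl⟩ := hxc
      exact Or.inl (hc0 i)
    · exact Or.inr (by simpa [hx] using hxc)
  · rw [hcard, Finset.card_sdiff_of_subset (by
      intro x hx
      simp only [Finset.mem_image, Finset.mem_univ, true_and] at hx
      exact Set.mem_toFinset.2 (hcB hx)), Finset.card_image_of_injective _ hcQ.injective,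
      Finset.card_univ, Fintype.card_fin]
    refine (Nat.sub_add_cancel ?_).le
    rw [← Fintype.card_fin (finrank ℚ E), ← Finset.card_univ,
      ← Finset.card_image_of_injective _ hcQ.injective]
    refine Finset.card_le_card fun x hx => ?_
    simp only [Finset.mem_image, Finset.mem_univ, true_and] at hx
    exact Set.mem_toFinset.2 (hcB hx)

theorem Derivation.card_le_of_exponential_pairs (D : Derivation ℤ F F) {l : F} (hl : D l ≠ 0)
    {ι : Type*} [Fintype ι] (x y z : ι → F) (hx : LinearIndependent ℚ x)
    (hy : ∀ i, y i ≠ 0) (hz : ∀ i, z i ≠ 0) (hxy : ∀ i, D (y i) = y i * D (x i))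
    (hxz : ∀ i, D (z i) = z i * D (l * x i)) (k : Subfield F) (s : Finset F)
    (hk : ∀ δ : Derivation ℤ F F, δ l = 0 → (∀ a ∈ s, δ a = 0) → ∀ c ∈ k, δ c = 0)
    (hyk : ∀ i, IsAlgebraic k (y i)) (hzk : ∀ i, IsAlgebraic k (z i)) :
    Fintype.card ι ≤ s.card := by
  classical
  have hlQ : Transcendental ℚ l := by
    intro h
    refine hl (D.eq_zero_of_isAlgebraic D.constants (fun _ => Derivation.mem_constants.1) ?_)
    exact h.tower_top (K := ℚ) (L := D.constants)
  set K := IntermediateField.adjoin ℚ {l} with hK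
  have hlK : l ∈ K := IntermediateField.mem_adjoin_simple_self ℚ l
  let v : ι ⊕ ι → F := Sum.elim x fun i => l * x i
  let w : ι ⊕ ι → F := Sum.elim y z
  let V := Submodule.span ℚ (Set.range x)
  let V' := Submodule.span ℚ (Set.range v)
  have hVV' : V ⊔ V.map (LinearMap.mulLeft ℚ l) = V' := by
    rw [Submodule.map_span, ← Submodule.span_union, ← Set.range_comp]
    exact congrArg _ (Set.Sum.elim_range _ _).symm
  have hVcard : finrank ℚ V = Fintype.card ι := finrank_span_eq_card hx
  have : FiniteDimensional ℚ V := FiniteDimensional.span_of_finite ℚ (Set.finite_range x)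
  have hkron := finrank_add_finrank_span_le hlQ K hlK V
  rw [hVV', hVcard] at hkron
  have hspan : Submodule.span K (V' : Set F) = Submodule.span K (V : Set F) := by
    refine le_antisymm (Submodule.span_le.2 fun a ha => ?_)
      (Submodule.span_mono (show V ≤ V' from hVV' ▸ le_sup_left))
    have hle : V' ≤ (Submodule.span K (V : Set F)).restrictScalars ℚ := by
      refine Submodule.span_le.2 ?_
      rintro _ ⟨i | i, rfl⟩
      · exact Submodule.subset_span (Submodule.subset_span ⟨i, rfl⟩)
      · exact Submodule.smul_mem _ (⟨l, hlK⟩ : K)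
          (Submodule.subset_span (Submodule.subset_span ⟨i, rfl⟩))
    exact hle ha
  have : FiniteDimensional ℚ V' := FiniteDimensional.span_of_finite ℚ (Set.finite_range v)
  obtain ⟨b, hbspan, hbcard⟩ := D.exists_finset_span hl V'
  rw [← hK, hspan] at hbcard
  have hrank := LinearMap.finrank_range_add_finrank_ker (D.toRatLinearMap.domRestrict V')
  obtain ⟨κ, a, ha, hspana, hlia⟩ := exists_linearIndependent' ℚ (D.toRatLinearMap ∘ v)
  have : Finite κ := Finite.of_injective a ha
  let := Fintype.ofFinite κ
  have hκ : finrank ℚ (LinearMap.range (D.toRatLinearMap.domRestrict V')) = Fintype.card κ := by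
    rw [← finrank_span_eq_card hlia, hspana, LinearMap.range_domRestrict, Submodule.map_span,
      Set.range_comp]
  have hker : finrank ℚ (LinearMap.ker (D.toRatLinearMap.domRestrict V')) =
      finrank ℚ ↥(V' ⊓ LinearMap.ker D.toRatLinearMap) := by
    rw [LinearMap.ker_domRestrict, ← Submodule.finrank_map_subtype_eq, Submodule.map_comap_subtype]
  rw [hκ, hker] at hrank
  have hmain := D.card_lt_card_of_exponential_relations l hl (v ∘ a) (w ∘ a)
    (fun j : (insert l (b ∪ s) : Finset F) => (j : F)) ?_ ?_ ?_ ?_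
  · have h1 : Fintype.card (insert l (b ∪ s) : Finset F) ≤ b.card + s.card + 1 := by
      rw [Fintype.card_coe]
      exact (Finset.card_insert_le _ _).trans (Nat.add_le_add_right (Finset.card_union_le _ _) 1)
    omega
  · rintro i
    rcases h : a i with j | j <;> simp [w, h, hy, hz]
  · rintro i
    rcases h : a i with j | j <;> simp only [Function.comp_apply, h]
    · exact hxy j
    · exact hxz j
  · intro δ hδD hδ
    have hδl : δ l = 0 := hδ ⟨l, Finset.mem_insert_self _ _⟩
    have hδb : ∀ a ∈ b, δ a = 0 := fun a ha =>
      hδ ⟨a, Finset.mem_insert_of_mem (Finset.mem_union_left _ ha)⟩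
    have hδs : ∀ a ∈ s, δ a = 0 := fun a ha =>
      hδ ⟨a, Finset.mem_insert_of_mem (Finset.mem_union_right _ ha)⟩
    have hδspan : ∀ u ∈ Submodule.span K ({c | D c = 0} ∪ (b : Set F)), δ u = 0 := by
      intro u hu
      induction hu using Submodule.span_induction with
      | mem u hu => exact hu.elim (hδD u) (hδb u)
      | zero => exact map_zero δ
      | add u u' _ _ h h' => rw [map_add, h, h', add_zero]
      | smul c u _ h =>
        rw [IntermediateField.smul_def, smul_eq_mul, δ.leibniz, h,
          δ.eq_zero_of_mem_adjoin hδl c.2, smul_zero, smul_zero, add_zero]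
    have hδw : ∀ j, δ (w j) = 0 := by
      rintro (j | j)
      · exact δ.eq_zero_of_isAlgebraic k (hk δ hδl hδs) (hyk j)
      · exact δ.eq_zero_of_isAlgebraic k (hk δ hδl hδs) (hzk j)
    exact ⟨hδl, fun i => ⟨hδspan _ (hbspan (Submodule.subset_span ⟨a i, rfl⟩)), hδw (a i)⟩⟩
  · intro m hm
    have hliZ : LinearIndependent ℤ (D.toRatLinearMap ∘ v ∘ a) :=
      LinearIndependent.restrict_scalars' ℤ hlia
    refine funext fun i => Fintype.linearIndependent_iff.1 hliZ m ?_ i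
    rw [← hm]
    simp

end Counting

theorem exists_finset_card_le_td {F : Type*} [Field F] (l : F) {S : Set F} (hS : S.Finite) :
    ∃ s : Finset F, (s.card : Cardinal) ≤ td S {l} ∧
      ∀ y ∈ S, IsAlgebraic
        (IntermediateField.adjoin (Subfield.closure {l}) (s : Set F)).toSubfield y := by
  obtain ⟨u, -, hu⟩ := exists_maximal_algebraicIndependent (R := Subfield.closure {l}) (∅ : Set F) S
    (Set.empty_subset _)
    ((algebraicIndependent_empty_iff _ F).2 (FaithfulSMul.algebraMap_injective _ F))
  obtain ⟨s, rfl⟩ := (hS.subset hu.prop.2).exists_finset_coe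
  refine ⟨s, ?_, fun y hy => ?_⟩
  · have := le_ciSup (f := fun t : {t : Set F // t ⊆ ↑(Subfield.closure (S ∪ {l})) ∧
        AlgebraicIndependent ↥(Subfield.closure {l}) ((↑) : t → F)} => Cardinal.mk t.1)
      Cardinal.bddAbove_of_small
      ⟨s, fun a ha => Subfield.subset_closure (Or.inl (hu.prop.2 ha)), hu.prop.1⟩
    simpa [td] using this
  · have halg : IsAlgebraic (Algebra.adjoin (Subfield.closure {l}) (s : Set F)) y := by
      by_contra htr
      have hins : AlgebraicIndepOn (Subfield.closure {l}) id (insert y (s : Set F)) :=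
        hu.prop.1.insert (by rwa [Set.image_id])
      have hys := hu.le_of_ge ⟨hins, Set.insert_subset hy hu.prop.2⟩ (Set.subset_insert _ _)
        (Set.mem_insert _ _)
      exact htr (isAlgebraic_algebraMap
        (⟨y, Algebra.subset_adjoin hys⟩ : Algebra.adjoin (Subfield.closure {l}) (s : Set F)))
    open scoped IntermediateField.algebraAdjoinAdjoin in
    have := halg.extendScalars (S := IntermediateField.adjoin (Subfield.closure {l}) (s : Set F))
      (FaithfulSMul.algebraMap_injective _ _)
    exact this

theorem Derivation.eq_zero_of_mem_adjoin_closure {F : Type*} [Field F] (δ : Derivation ℤ F F)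
    {l : F} (hl : δ l = 0) {s : Set F} (hs : ∀ a ∈ s, δ a = 0) {c : F}
    (hc : c ∈ IntermediateField.adjoin (Subfield.closure {l}) s) : δ c = 0 := by
  have hcl : Subfield.closure {l} ≤ δ.constants :=
    Subfield.closure_le.2 (Set.singleton_subset_iff.2 (Derivation.mem_constants.2 hl))
  rw [← Derivation.mem_constants]
  induction hc using IntermediateField.adjoin_induction with
  | mem x hx => exact Derivation.mem_constants.2 (hs x hx)
  | algebraMap q => exact hcl q.2
  | add x y _ _ hx hy => exact add_mem hx hy
  | inv x _ hx => exact inv_mem hx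
  | mul x y _ _ hx hy => exact mul_mem hx hy

theorem Real.linearIndependent_of_exp {ι : Type*} [Fintype ι] {x : ι → ℝ}
    (h : ∀ m : ι → ℤ, ∏ i, Real.exp (x i) ^ m i = 1 → ∀ i, m i = 0) : LinearIndependent ℚ x := by
  rw [← LinearIndependent.iff_fractionRing ℤ ℚ, Fintype.linearIndependent_iff]
  intro m hm
  refine h m ?_
  rw [← Real.exp_zero, ← hm, Real.exp_sum]
  refine Finset.prod_congr rfl fun i _ => ?_
  rw [zsmul_eq_mul, mul_comm, Real.exp_mul, Real.rpow_intCast]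

/-- Theorem 1.2 for `F = ℝ`: if `λ` is exponentially transcendental and
`exp x₁, …, exp xₙ` are multiplicatively independent, then
`td(ℚ(λ, exp x, exp (λx))/ℚ(λ)) ≥ n`. -/
theorem exp_powers_schanuel (l : ℝ) (hl : ¬ IsExpAlgebraic l)
    (n : ℕ) (x : Fin n → ℝ)
    (hmi : ∀ m : Fin n → ℤ, ∏ i, Real.exp (x i) ^ m i = 1 → ∀ i, m i = 0) :
    (n : Cardinal) ≤
      td ((Set.range fun i => Real.exp (x i)) ∪ Set.range fun i => Real.exp (l * x i))
        {l} := by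
  obtain ⟨s, hs, halg⟩ := exists_finset_card_le_td l
    ((Set.finite_range fun i => Real.exp (x i)).union
      (Set.finite_range fun i => Real.exp (l * x i)))
  refine le_trans ?_ hs
  obtain ⟨D, hDl, hD⟩ := exists_exponential_derivation_ne_zero (Nat.succ_pos (n + n))
    (Fin.cons l (Fin.append x fun i => l * x i)) (by simpa using hl)
  have hx : ∀ i, D (Real.exp (x i)) = Real.exp (x i) * D (x i) := fun i => by
    simpa using hD (Fin.succ (Fin.castAdd n i))
  have hlx : ∀ i, D (Real.exp (l * x i)) = Real.exp (l * x i) * D (l * x i) := fun i => by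
    simpa only [Fin.cons_succ, Fin.append_right] using hD (Fin.succ (Fin.natAdd n i))
  have := D.card_le_of_exponential_pairs hDl x _ _ (Real.linearIndependent_of_exp hmi)
    (fun i => Real.exp_ne_zero _) (fun i => Real.exp_ne_zero _) hx hlx _ s
    (fun δ hδl hδs c hc => δ.eq_zero_of_mem_adjoin_closure hδl hδs hc)
    (fun i => halg _ (Or.inl ⟨i, rfl⟩)) (fun i => halg _ (Or.inr ⟨i, rfl⟩))
  rw [Fintype.card_fin] at this
  exact_mod_cast this
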